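/- arXiv:2002.02085 — 9 statements merged into one kernel-verified Lean document; each statement's English description precedes it below -/
import Mathlib

section
/- Let Ω ⊆ ℝ^d be a nonempty compact convex set with diameter at most D, and for t = 1,…,T let f_t : ℝ^d → ℝ be convex and differentiable with ‖∇f_t(w)‖₂ ≤ G for all w ∈ Ω. Let w_1 ∈ Ω be arbitrary and define online gradient descent iterates w_{t+1} = Π_Ω[w_t − η∇f_t(w_t)] for a step size η > 0, where Π_Ω is the Euclidean projection onto Ω. Then Σ_{t=1}^T f_t(w_t) − min_{w∈Ω} Σ_{t=1}^T f_t(w) ≤ D²/(2η) + ηTG²/2; in particular, with η = D/(G√T) the right-hand side equals DG√T. -/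
open scoped InnerProductSpace in
/-- First-order lower bound for a convex function differentiable at `x`. -/
theorem ConvexOn.inner_gradient_le_sub {E : Type*} [NormedAddCommGroup E]
    [InnerProductSpace ℝ E] [CompleteSpace E] {f : E → ℝ} (hf : ConvexOn ℝ Set.univ f) {x : E}
    (hx : DifferentiableAt ℝ f x) (y : E) : ⟪gradient f x, y - x⟫_ℝ ≤ f y - f x := by
  have hconv : ConvexOn ℝ Set.univ (f ∘ AffineMap.lineMap (k := ℝ) x y) := by
    simpa using hf.comp_affineMap (AffineMap.lineMap (k := ℝ) x y)
  have hf' : HasFDerivAt f (InnerProductSpace.toDual ℝ E (gradient f x))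
      (AffineMap.lineMap (k := ℝ) x y 0) := by
    simpa using hx.hasGradientAt.hasFDerivAt
  have hderiv : HasDerivAt (f ∘ AffineMap.lineMap (k := ℝ) x y) ⟪gradient f x, y - x⟫_ℝ 0 := by
    simpa using hf'.comp_hasDerivAt (0 : ℝ) AffineMap.hasDerivAt_lineMap
  simpa [slope_def_field] using
    hconv.le_slope_of_hasDerivAt (Set.mem_univ 0) (Set.mem_univ 1) zero_lt_one hderiv

open scoped InnerProductSpace in
/-- A nearest point of a convex set to `y` is at least as close to every point of the set as `y`. -/
theorem Convex.norm_sub_le_of_forall_norm_sub_le {E : Type*} [NormedAddCommGroup E]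
    [InnerProductSpace ℝ E] {K : Set E} (hK : Convex ℝ K) {p y v : E} (hp : p ∈ K)
    (hmin : ∀ z ∈ K, ‖p - y‖ ≤ ‖z - y‖) (hv : v ∈ K) : ‖p - v‖ ≤ ‖y - v‖ := by
  have : Nonempty K := ⟨⟨p, hp⟩⟩
  have hinf : ‖y - p‖ = ⨅ z : K, ‖y - z‖ := by
    refine le_antisymm (le_ciInf fun z => ?_)
      (ciInf_le (f := fun z : K => ‖y - z‖) ⟨0, ?_⟩ ⟨p, hp⟩)
    · rw [norm_sub_rev y p, norm_sub_rev y z]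
      exact hmin z z.2
    · rintro _ ⟨z, rfl⟩
      exact norm_nonneg _
  have hin := (norm_eq_iInf_iff_real_inner_le_zero hK hp).1 hinf v hv
  have hsq : ‖y - v‖ ^ 2 = ‖y - p‖ ^ 2 - 2 * ⟪y - p, v - p⟫_ℝ + ‖p - v‖ ^ 2 := by
    rw [← sub_sub_sub_cancel_right y v p, norm_sub_sq_real, norm_sub_rev v p]
  exact le_of_sq_le_sq (by nlinarith [sq_nonneg ‖y - p‖]) (norm_nonneg _)

/-- One step of projected gradient descent on a convex function. -/
theorem ConvexOn.sub_le_of_projected_gradient_step {E : Type*} [NormedAddCommGroup E]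
    [InnerProductSpace ℝ E] [CompleteSpace E] {f : E → ℝ} (hf : ConvexOn ℝ Set.univ f) {x : E}
    (hx : DifferentiableAt ℝ f x) {G η : ℝ} (hη : 0 < η) (hG : ‖gradient f x‖ ≤ G)
    {K : Set E} (hK : Convex ℝ K) {p v : E} (hp : p ∈ K)
    (hmin : ∀ z ∈ K, ‖p - (x - η • gradient f x)‖ ≤ ‖z - (x - η • gradient f x)‖) (hv : v ∈ K) :
    f x - f v ≤ (‖x - v‖ ^ 2 - ‖p - v‖ ^ 2) / (2 * η) + η * G ^ 2 / 2 := by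
  have hgrad := hf.inner_gradient_le_sub hx v
  have hproj := pow_le_pow_left₀ (norm_nonneg _)
    (hK.norm_sub_le_of_forall_norm_sub_le hp hmin hv) 2
  rw [sub_right_comm, norm_sub_sq_real (x - v), real_inner_smul_right, norm_smul, mul_pow,
    Real.norm_eq_abs, sq_abs, real_inner_comm, ← neg_sub v x, inner_neg_right, norm_neg] at hproj
  have hsq := pow_le_pow_left₀ (norm_nonneg _) hG 2
  rw [← neg_sub v x, norm_neg, ← sub_le_iff_le_add, le_div_iff₀ (by positivity)]
  nlinarith [mul_le_mul_of_nonneg_left hgrad hη.le,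
    mul_le_mul_of_nonneg_left hsq (sq_nonneg η)]

/-- Theorem 2, static regret of online gradient descent.
Ω ⊆ ℝ^d is a nonempty compact convex set of diameter at most `D`, the losses
`f t` are convex differentiable with gradients bounded by `G` on Ω, `proj` is the
Euclidean projection onto Ω (characterized as the nearest-point map), and
`w` is the OGD trajectory with step size `η > 0` started at `w 1 ∈ Ω`.  Then the
static regret over rounds `1,…,T` is at most `D²/(2η) + ηTG²/2`, and with
`η = D/(G√T)` this bound equals `DG√T`. -/
theorem ogd_static_regret
    (d T : ℕ) (D G η : ℝ) (hη : 0 < η)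
    (Ω : Set (EuclideanSpace ℝ (Fin d)))
    (hne : Ω.Nonempty) (hcomp : IsCompact Ω) (hconv : Convex ℝ Ω)
    (hdiam : ∀ x ∈ Ω, ∀ y ∈ Ω, ‖x - y‖ ≤ D)
    (f : ℕ → EuclideanSpace ℝ (Fin d) → ℝ)
    (hfconv : ∀ t, ConvexOn ℝ Set.univ (f t))
    (hfdiff : ∀ t y, DifferentiableAt ℝ (f t) y)
    (hgrad : ∀ t, ∀ y ∈ Ω, ‖gradient (f t) y‖ ≤ G)
    (proj : EuclideanSpace ℝ (Fin d) → EuclideanSpace ℝ (Fin d))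
    (hproj : ∀ y, proj y ∈ Ω ∧ ∀ z ∈ Ω, ‖proj y - y‖ ≤ ‖z - y‖)
    (w : ℕ → EuclideanSpace ℝ (Fin d)) (hw1 : w 1 ∈ Ω)
    (hupd : ∀ t, 1 ≤ t → w (t + 1) = proj (w t - η • gradient (f t) (w t))) :
    (∀ v ∈ Ω, ∑ t ∈ Finset.Icc 1 T, f t (w t) - ∑ t ∈ Finset.Icc 1 T, f t v
        ≤ D ^ 2 / (2 * η) + η * T * G ^ 2 / 2) ∧
    (η = D / (G * Real.sqrt T) →
        D ^ 2 / (2 * η) + η * T * G ^ 2 / 2 = D * G * Real.sqrt T) := by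
  constructor
  · intro v hv
    have hw : ∀ t, 1 ≤ t → w t ∈ Ω := by
      intro t ht
      induction t, ht using Nat.le_induction with
      | base => exact hw1
      | succ t ht _ => exact hupd t ht ▸ (hproj _).1
    have hstep : ∀ t, 1 ≤ t → f t (w t) - f t v ≤
        (‖w t - v‖ ^ 2 - ‖w (t + 1) - v‖ ^ 2) / (2 * η) + η * G ^ 2 / 2 := by
      intro t ht
      rw [hupd t ht]
      exact (hfconv t).sub_le_of_projected_gradient_step (hfdiff t _) hη
        (hgrad t _ (hw t ht)) hconv (hproj _).1 (hproj _).2 hv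
    have htelescope : ∑ t ∈ Finset.Icc 1 T, f t (w t) - ∑ t ∈ Finset.Icc 1 T, f t v ≤
        (‖w 1 - v‖ ^ 2 - ‖w (T + 1) - v‖ ^ 2) / (2 * η) + η * T * G ^ 2 / 2 := by
      induction T with
      | zero => simp
      | succ T ih =>
        rw [Finset.sum_Icc_succ_top (by lia), Finset.sum_Icc_succ_top (by lia)]
        have hlast := hstep (T + 1) (by lia)
        rw [sub_div] at ih hlast ⊢
        push_cast
        linarith
    refine htelescope.trans ?_
    gcongr
    have := pow_le_pow_left₀ (norm_nonneg _) (hdiam _ hw1 _ hv) 2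
    linarith [sq_nonneg ‖w (T + 1) - v‖]
  · intro h
    have hne0 : D / (G * Real.sqrt T) ≠ 0 := h ▸ hη.ne'
    obtain ⟨hD, hGT⟩ := div_ne_zero_iff.1 hne0
    obtain ⟨hG, hT⟩ := mul_ne_zero_iff.1 hGT
    have hsq : (T : ℝ) = Real.sqrt T ^ 2 := (Real.sq_sqrt T.cast_nonneg).symm
    rw [h]
    generalize Real.sqrt T = s at *
    rw [hsq]
    field_simp
    ring
end

section
/- Let Ω ⊆ ℝ^d be a nonempty compact convex set with diameter at most D, and for t = 1,…,T let f_t : ℝ^d → ℝ be convex and differentiable with ‖∇f_t(w)‖₂ ≤ G for all w ∈ Ω. Let w_1 ∈ Ω and w_{t+1} = Π_Ω[w_t − η∇f_t(w_t)] with step size η > 0. Then for any comparator sequence u_1,…,u_{T+1} ∈ Ω, Σ_{t=1}^T f_t(w_t) − Σ_{t=1}^T f_t(u_t) ≤ (1/(2η))(‖w_1−u_1‖₂² − ‖w_{T+1}−u_{T+1}‖₂²) + (D/η)·Σ_{t=1}^T ‖u_{t+1}−u_t‖₂ + ηTG²/2. -/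
open scoped InnerProductSpace in
theorem ConvexOn.sub_le_inner_gradient {E : Type*} [NormedAddCommGroup E]
    [InnerProductSpace ℝ E] [CompleteSpace E] {f : E → ℝ} (hf : ConvexOn ℝ Set.univ f) {x : E}
    (hd : DifferentiableAt ℝ f x) (y : E) :
    f x - f y ≤ ⟪gradient f x, x - y⟫_ℝ := by
  have hline : HasDerivAt (f ∘ AffineMap.lineMap (k := ℝ) x y) ⟪gradient f x, y - x⟫_ℝ 0 := by
    have hx : HasFDerivAt f (InnerProductSpace.toDual ℝ E (gradient f x))
        (AffineMap.lineMap (k := ℝ) x y 0) := by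
      simpa using hd.hasGradientAt.hasFDerivAt
    simpa using hx.comp_hasDerivAt (0 : ℝ) AffineMap.hasDerivAt_lineMap
  have h := (hf.comp_affineMap (AffineMap.lineMap (k := ℝ) x y)).le_slope_of_hasDerivAt
    (Set.mem_univ _) (Set.mem_univ _) zero_lt_one hline
  simp only [slope_def_field, Function.comp_apply, AffineMap.lineMap_apply_one,
    AffineMap.lineMap_apply_zero, sub_zero, div_one] at h
  rw [← neg_sub y x, inner_neg_right]
  linarith

open scoped InnerProductSpace in
theorem Convex.norm_sub_le_of_isNearest {E : Type*} [NormedAddCommGroup E]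
    [InnerProductSpace ℝ E] {K : Set E} (hK : Convex ℝ K) {p y z : E} (hp : p ∈ K)
    (hmin : ∀ v ∈ K, ‖p - y‖ ≤ ‖v - y‖) (hz : z ∈ K) : ‖p - z‖ ≤ ‖y - z‖ := by
  have hinf : ‖y - p‖ = ⨅ v : K, ‖y - v‖ := by
    have : Nonempty K := ⟨⟨p, hp⟩⟩
    refine le_antisymm (le_ciInf fun v => ?_)
      (ciInf_le ⟨0, Set.forall_mem_range.2 fun _ => norm_nonneg _⟩ (⟨p, hp⟩ : K))
    simpa only [norm_sub_rev y] using hmin v v.2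
  have h := (norm_eq_iInf_iff_real_inner_le_zero hK hp).1 hinf z hz
  have hexp := norm_sub_sq_real (y - p) (z - p)
  rw [sub_sub_sub_cancel_right, norm_sub_rev z p] at hexp
  exact (sq_le_sq₀ (norm_nonneg _) (norm_nonneg _)).1 (by nlinarith [sq_nonneg ‖y - p‖])

open scoped InnerProductSpace in
/-- One step of projected gradient descent, measured against a comparator moving from `u` to
`u'`. -/
theorem ConvexOn.projected_gradient_step {E : Type*} [NormedAddCommGroup E]
    [InnerProductSpace ℝ E] [CompleteSpace E] {f : E → ℝ} (hf : ConvexOn ℝ Set.univ f)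
    {K : Set E} (hK : Convex ℝ K) {D G η : ℝ} (hη : 0 < η)
    (hdiam : ∀ x ∈ K, ∀ y ∈ K, ‖x - y‖ ≤ D) {w p u u' : E}
    (hd : DifferentiableAt ℝ f w) (hG : ‖gradient f w‖ ≤ G) (hp : p ∈ K)
    (hmin : ∀ v ∈ K, ‖p - (w - η • gradient f w)‖ ≤ ‖v - (w - η • gradient f w)‖)
    (hu : u ∈ K) (hu' : u' ∈ K) :
    f w - f u ≤ (1 / (2 * η)) * (‖w - u‖ ^ 2 - ‖p - u'‖ ^ 2) + (D / η) * ‖u' - u‖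
      + η * G ^ 2 / 2 := by
  set g := gradient f w
  have hlin : f w - f u ≤ ⟪g, w - u⟫_ℝ := hf.sub_le_inner_gradient hd u
  have hproj : ‖p - u‖ ^ 2 ≤ ‖w - u‖ ^ 2 - 2 * η * ⟪g, w - u⟫_ℝ + η ^ 2 * ‖g‖ ^ 2 := by
    have h := pow_le_pow_left₀ (norm_nonneg _) (hK.norm_sub_le_of_isNearest hp hmin hu) 2
    rw [sub_right_comm, norm_sub_sq_real (w - u), real_inner_smul_right, real_inner_comm, norm_smul,
      Real.norm_of_nonneg hη.le] at h
    rw [mul_pow] at h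
    linarith
  have hgrad : ‖g‖ ^ 2 ≤ G ^ 2 := pow_le_pow_left₀ (norm_nonneg _) hG 2
  have hmove : ‖p - u'‖ ^ 2 - ‖p - u‖ ^ 2 ≤ 2 * D * ‖u' - u‖ := by
    have htri : ‖p - u'‖ - ‖p - u‖ ≤ ‖u' - u‖ := by
      simpa only [sub_sub_sub_cancel_left, norm_sub_rev u] using
        norm_sub_norm_le (p - u') (p - u)
    have hsum : ‖p - u'‖ + ‖p - u‖ ≤ 2 * D := by linarith [hdiam p hp u' hu', hdiam p hp u hu]
    calc ‖p - u'‖ ^ 2 - ‖p - u‖ ^ 2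
        = (‖p - u'‖ + ‖p - u‖) * (‖p - u'‖ - ‖p - u‖) := by ring
      _ ≤ (‖p - u'‖ + ‖p - u‖) * ‖u' - u‖ := by gcongr
      _ ≤ 2 * D * ‖u' - u‖ := by gcongr
  have hscaled : 2 * η * (f w - f u) ≤
      ‖w - u‖ ^ 2 - ‖p - u'‖ ^ 2 + 2 * D * ‖u' - u‖ + η ^ 2 * G ^ 2 := by
    have h₁ : 2 * η * (f w - f u) ≤ 2 * η * ⟪g, w - u⟫_ℝ := by gcongr
    have h₂ : η ^ 2 * ‖g‖ ^ 2 ≤ η ^ 2 * G ^ 2 := by gcongr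
    linarith
  calc f w - f u
      = 2 * η * (f w - f u) / (2 * η) := by field_simp
    _ ≤ (‖w - u‖ ^ 2 - ‖p - u'‖ ^ 2 + 2 * D * ‖u' - u‖ + η ^ 2 * G ^ 2) / (2 * η) := by gcongr
    _ = _ := by field_simp


/-- Theorem 7, dynamic regret of online gradient descent.
Under the same OGD setup, for any comparator sequence `u 1, …, u (T+1) ∈ Ω`,
the dynamic regret is bounded by
`(1/(2η))(‖w₁−u₁‖² − ‖w_{T+1}−u_{T+1}‖²) + (D/η)·Σ‖u_{t+1}−u_t‖ + ηTG²/2`. -/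
theorem ogd_dynamic_regret
    (d T : ℕ) (D G η : ℝ) (hη : 0 < η)
    (Ω : Set (EuclideanSpace ℝ (Fin d)))
    (hne : Ω.Nonempty) (hcomp : IsCompact Ω) (hconv : Convex ℝ Ω)
    (hdiam : ∀ x ∈ Ω, ∀ y ∈ Ω, ‖x - y‖ ≤ D)
    (f : ℕ → EuclideanSpace ℝ (Fin d) → ℝ)
    (hfconv : ∀ t, ConvexOn ℝ Set.univ (f t))
    (hfdiff : ∀ t y, DifferentiableAt ℝ (f t) y)
    (hgrad : ∀ t, ∀ y ∈ Ω, ‖gradient (f t) y‖ ≤ G)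
    (proj : EuclideanSpace ℝ (Fin d) → EuclideanSpace ℝ (Fin d))
    (hproj : ∀ y, proj y ∈ Ω ∧ ∀ z ∈ Ω, ‖proj y - y‖ ≤ ‖z - y‖)
    (w : ℕ → EuclideanSpace ℝ (Fin d)) (hw1 : w 1 ∈ Ω)
    (hupd : ∀ t, 1 ≤ t → w (t + 1) = proj (w t - η • gradient (f t) (w t)))
    (u : ℕ → EuclideanSpace ℝ (Fin d))
    (hu : ∀ t, 1 ≤ t → t ≤ T + 1 → u t ∈ Ω) :
    ∑ t ∈ Finset.Icc 1 T, f t (w t) - ∑ t ∈ Finset.Icc 1 T, f t (u t)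
      ≤ (1 / (2 * η)) * (‖w 1 - u 1‖ ^ 2 - ‖w (T + 1) - u (T + 1)‖ ^ 2)
        + (D / η) * ∑ t ∈ Finset.Icc 1 T, ‖u (t + 1) - u t‖
        + η * T * G ^ 2 / 2 := by
  have hw : ∀ t, 1 ≤ t → w t ∈ Ω := by
    intro t ht
    induction t, ht using Nat.le_induction with
    | base => exact hw1
    | succ t ht _ => exact hupd t ht ▸ (hproj _).1
  have hstep : ∀ t ∈ Finset.Icc 1 T, f t (w t) - f t (u t) ≤
      (1 / (2 * η)) * (‖w t - u t‖ ^ 2 - ‖w (t + 1) - u (t + 1)‖ ^ 2)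
        + (D / η) * ‖u (t + 1) - u t‖ + η * G ^ 2 / 2 := by
    intro t ht
    obtain ⟨h₁, h₂⟩ := Finset.mem_Icc.1 ht
    refine (hfconv t).projected_gradient_step hconv hη hdiam (hfdiff t _)
      (hgrad t _ (hw t h₁)) (hw _ (by omega)) ?_ (hu t h₁ (by omega)) (hu _ (by omega) (by omega))
    rw [hupd t h₁]
    exact (hproj _).2
  have htele : ∑ t ∈ Finset.Icc 1 T, (‖w t - u t‖ ^ 2 - ‖w (t + 1) - u (t + 1)‖ ^ 2) =
      ‖w 1 - u 1‖ ^ 2 - ‖w (T + 1) - u (T + 1)‖ ^ 2 := by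
    rw [← Finset.Ico_add_one_right_eq_Icc]
    have h := Finset.sum_Ico_sub (fun t => ‖w t - u t‖ ^ 2) (Nat.le_add_left 1 T)
    rw [← neg_inj, ← Finset.sum_neg_distrib]
    simpa only [neg_sub] using h
  rw [← Finset.sum_sub_distrib]
  refine (Finset.sum_le_sum hstep).trans_eq ?_
  rw [Finset.sum_add_distrib, Finset.sum_add_distrib, ← Finset.mul_sum, ← Finset.mul_sum, htele,
    Finset.sum_const, Nat.card_Icc, Nat.add_sub_cancel, nsmul_eq_mul]
  ring
end

section
/- Let Ω ⊆ ℝ^d be a nonempty compact convex set and for t = 1,…,T let f_t : Ω → ℝ be continuous and G-Lipschitz with respect to ‖·‖₂ on Ω. Let w_1,…,w_T ∈ Ω be any learner sequence and u_1,…,u_T ∈ Ω any comparator sequence. Then for every partition of [1,T] into consecutive intervals I_1 = [s_1,q_1], …, I_k = [s_k,q_k], Σ_{t=1}^T f_t(w_t) − Σ_{t=1}^T f_t(u_t) ≤ Σ_{i=1}^k ( SAReg(T,|I_i|) + G·|I_i|·P_T(i) ), where P_T(i) = Σ_{t=s_i}^{q_i−1} ‖u_{t+1}−u_t‖₂. 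-/
/-- The strongly adaptive regret `SAReg(T,τ)` of the learner sequence `w` against
losses `f` over domain `Ω`: the supremum over intervals `[s, s+τ−1] ⊆ [1,T]` of the
static regret on that interval (the inner minimum is `sInf` of the image of Ω). -/
noncomputable def SAReg {d : ℕ} (Ω : Set (EuclideanSpace ℝ (Fin d)))
    (f : ℕ → EuclideanSpace ℝ (Fin d) → ℝ) (w : ℕ → EuclideanSpace ℝ (Fin d))
    (T τ : ℕ) : ℝ :=
  sSup { r : ℝ | ∃ s : ℕ, 1 ≤ s ∧ s + τ - 1 ≤ T ∧
    r = (∑ t ∈ Finset.Icc s (s + τ - 1), f t (w t)) -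
        sInf ((fun v => ∑ t ∈ Finset.Icc s (s + τ - 1), f t v) '' Ω) }

theorem static_regret_le_SAReg {d : ℕ} {Ω : Set (EuclideanSpace ℝ (Fin d))}
    {f : ℕ → EuclideanSpace ℝ (Fin d) → ℝ} (hcomp : IsCompact Ω)
    (hcont : ∀ t, ContinuousOn (f t) Ω) (w : ℕ → EuclideanSpace ℝ (Fin d))
    {T a b : ℕ} (ha : 1 ≤ a) (hab : a ≤ b) (hb : b ≤ T)
    {v : EuclideanSpace ℝ (Fin d)} (hv : v ∈ Ω) :
    ∑ t ∈ Finset.Icc a b, f t (w t) - ∑ t ∈ Finset.Icc a b, f t v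
      ≤ SAReg Ω f w T (b - a + 1) := by
  have hlen : a + (b - a + 1) - 1 = b := by omega
  have hbdd : BddBelow ((fun v => ∑ t ∈ Finset.Icc a b, f t v) '' Ω) :=
    (hcomp.image_of_continuousOn (continuousOn_finsetSum _ fun t _ => hcont t)).bddBelow
  refine (sub_le_sub_left (csInf_le hbdd (Set.mem_image_of_mem _ hv)) _).trans ?_
  refine le_csSup (Set.Finite.bddAbove ?_) ⟨a, ha, by omega, by rw [hlen]⟩
  refine ((Set.finite_Icc 1 T).image fun s =>
    (∑ t ∈ Finset.Icc s (s + (b - a + 1) - 1), f t (w t)) -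
      sInf ((fun v => ∑ t ∈ Finset.Icc s (s + (b - a + 1) - 1), f t v) '' Ω)).subset ?_
  rintro r ⟨s, hs, hsT, rfl⟩
  exact ⟨s, ⟨hs, by omega⟩, rfl⟩

theorem sub_le_mul_path_length {E : Type*} [SeminormedAddCommGroup E] {Ω : Set E}
    {g : E → ℝ} {G : ℝ} (hlip : ∀ x ∈ Ω, ∀ y ∈ Ω, |g x - g y| ≤ G * ‖x - y‖)
    {u : ℕ → E} {a b t : ℕ} (hu : ∀ j ∈ Finset.Icc a b, u j ∈ Ω)
    (hat : a ≤ t) (htb : t ≤ b) :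
    g (u a) - g (u t) ≤ G * ∑ j ∈ Finset.Ico a b, ‖u (j + 1) - u j‖ := by
  have hstep : ∀ j ∈ Finset.Ico a b,
      |g (u (j + 1)) - g (u j)| ≤ G * ‖u (j + 1) - u j‖ := fun j hj => by
    rw [Finset.mem_Ico] at hj
    exact hlip _ (hu _ (Finset.mem_Icc.2 ⟨by omega, by omega⟩)) _
      (hu _ (Finset.mem_Icc.2 ⟨by omega, by omega⟩))
  have hsub : Finset.Ico a t ⊆ Finset.Ico a b := Finset.Ico_subset_Ico_right htb
  calc g (u a) - g (u t) ≤ |∑ j ∈ Finset.Ico a t, (g (u (j + 1)) - g (u j))| := by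
        rw [Finset.sum_Ico_sub (fun j => g (u j)) hat, abs_sub_comm]
        exact le_abs_self _
    _ ≤ ∑ j ∈ Finset.Ico a t, |g (u (j + 1)) - g (u j)| := Finset.abs_sum_le_sum_abs _ _
    _ ≤ ∑ j ∈ Finset.Ico a b, |g (u (j + 1)) - g (u j)| :=
        Finset.sum_le_sum_of_subset_of_nonneg hsub fun _ _ _ => abs_nonneg _
    _ ≤ G * ∑ j ∈ Finset.Ico a b, ‖u (j + 1) - u j‖ := by
        rw [Finset.mul_sum]
        exact Finset.sum_le_sum hstep

theorem dynamic_regret_interval_le {d : ℕ} {Ω : Set (EuclideanSpace ℝ (Fin d))}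
    {f : ℕ → EuclideanSpace ℝ (Fin d) → ℝ} {G : ℝ} (hcomp : IsCompact Ω)
    (hcont : ∀ t, ContinuousOn (f t) Ω)
    (hlip : ∀ t, ∀ x ∈ Ω, ∀ y ∈ Ω, |f t x - f t y| ≤ G * ‖x - y‖)
    (w : ℕ → EuclideanSpace ℝ (Fin d)) {u : ℕ → EuclideanSpace ℝ (Fin d)} {T a b : ℕ}
    (hu : ∀ t ∈ Finset.Icc a b, u t ∈ Ω) (ha : 1 ≤ a) (hab : a ≤ b) (hb : b ≤ T) :
    ∑ t ∈ Finset.Icc a b, f t (w t) - ∑ t ∈ Finset.Icc a b, f t (u t)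
      ≤ SAReg Ω f w T (b - a + 1) + G * ((b - a + 1 : ℕ) : ℝ) *
          ∑ t ∈ Finset.Ico a b, ‖u (t + 1) - u t‖ := by
  have hstatic := static_regret_le_SAReg hcomp hcont w ha hab hb
    (hu a (Finset.left_mem_Icc.2 hab))
  have hdrift : ∑ t ∈ Finset.Icc a b, (f t (u a) - f t (u t)) ≤
      (Finset.Icc a b).card • (G * ∑ t ∈ Finset.Ico a b, ‖u (t + 1) - u t‖) :=
    Finset.sum_le_card_nsmul _ _ _ fun t ht =>
      sub_le_mul_path_length (hlip t) hu (Finset.mem_Icc.1 ht).1 (Finset.mem_Icc.1 ht).2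
  rw [Finset.sum_sub_distrib, Nat.card_Icc, show b + 1 - a = b - a + 1 by omega,
    nsmul_eq_mul] at hdrift
  linarith

theorem sum_Icc_eq_sum_consecutive {M : Type*} [AddCommMonoid M] (g : ℕ → M)
    {s q : ℕ → ℕ} {k : ℕ} (hk : 1 ≤ k) (hs1 : s 1 = 1)
    (hseg : ∀ i, 1 ≤ i → i ≤ k → s i ≤ q i)
    (hcons : ∀ i, 1 ≤ i → i < k → s (i + 1) = q i + 1) :
    ∑ t ∈ Finset.Icc 1 (q k), g t
      = ∑ i ∈ Finset.Icc 1 k, ∑ t ∈ Finset.Icc (s i) (q i), g t := by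
  induction k, hk using Nat.le_induction with
  | base => simp [hs1]
  | succ k hk ih =>
    rw [Finset.sum_Icc_succ_top (by omega), ← ih (fun i h1 h2 => hseg i h1 (by omega))
      (fun i h1 h2 => hcons i h1 (by omega))]
    have hle := hseg (k + 1) (by omega) le_rfl
    rw [hcons k hk (by omega)] at hle ⊢
    simp only [← Finset.Ico_add_one_right_eq_Icc]
    exact (Finset.sum_Ico_consecutive g (by omega) (by omega)).symm

/-- Theorem 1, partition bound: for continuous `G`-Lipschitz losses on a
nonempty compact convex `Ω`, any learner sequence `w`, any comparator sequence `u`,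
and any partition of `[1,T]` into consecutive intervals `[s i, q i]`, `i = 1,…,k`,
the dynamic regret is at most `Σᵢ (SAReg(T,|Iᵢ|) + G·|Iᵢ|·P_T(i))`. -/
theorem dynamic_regret_partition_bound
    (d T k : ℕ) (hT : 1 ≤ T) (hk : 1 ≤ k) (G : ℝ)
    (Ω : Set (EuclideanSpace ℝ (Fin d)))
    (hne : Ω.Nonempty) (hcomp : IsCompact Ω) (hconv : Convex ℝ Ω)
    (f : ℕ → EuclideanSpace ℝ (Fin d) → ℝ)
    (hcont : ∀ t, ContinuousOn (f t) Ω)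
    (hlip : ∀ t, ∀ x ∈ Ω, ∀ y ∈ Ω, |f t x - f t y| ≤ G * ‖x - y‖)
    (w u : ℕ → EuclideanSpace ℝ (Fin d))
    (hw : ∀ t, 1 ≤ t → t ≤ T → w t ∈ Ω)
    (hu : ∀ t, 1 ≤ t → t ≤ T → u t ∈ Ω)
    (s q : ℕ → ℕ) (hs1 : s 1 = 1) (hqk : q k = T)
    (hseg : ∀ i, 1 ≤ i → i ≤ k → s i ≤ q i)
    (hcons : ∀ i, 1 ≤ i → i < k → s (i + 1) = q i + 1) :
    ∑ t ∈ Finset.Icc 1 T, f t (w t) - ∑ t ∈ Finset.Icc 1 T, f t (u t)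
      ≤ ∑ i ∈ Finset.Icc 1 k,
          (SAReg Ω f w T (q i - s i + 1)
            + G * ((q i - s i + 1 : ℕ) : ℝ) *
                ∑ t ∈ Finset.Ico (s i) (q i), ‖u (t + 1) - u t‖) := by
  have hs_pos : ∀ i, 1 ≤ i → i ≤ k → 1 ≤ s i := fun i h1 h2 => by
    obtain rfl | ⟨j, hj, rfl⟩ : i = 1 ∨ ∃ j, 1 ≤ j ∧ i = j + 1 := by
      rcases h1.eq_or_lt with h | h
      · exact .inl h.symm
      · exact .inr ⟨i - 1, by omega, by omega⟩
    · exact hs1.ge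
    · rw [hcons j hj (by omega)]
      omega
  have hq_le : ∀ i, 1 ≤ i → i ≤ k → q i ≤ T := fun i h1 h2 => by
    induction h2 using Nat.decreasingInduction with
    | self => exact hqk.le
    | of_succ j hj ih =>
      have := ih (by omega)
      have := hcons j h1 hj
      have := hseg (j + 1) (by omega) hj
      omega
  rw [← hqk, sum_Icc_eq_sum_consecutive _ hk hs1 hseg hcons,
    sum_Icc_eq_sum_consecutive _ hk hs1 hseg hcons, ← Finset.sum_sub_distrib, hqk]
  refine Finset.sum_le_sum fun i hi => ?_
  obtain ⟨h1, h2⟩ := Finset.mem_Icc.1 hi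
  refine dynamic_regret_interval_le hcomp hcont hlip w (fun t ht => ?_) (hs_pos i h1 h2)
    (hseg i h1 h2) (hq_le i h1 h2)
  obtain ⟨hst, htq⟩ := Finset.mem_Icc.1 ht
  exact hu t ((hs_pos i h1 h2).trans hst) (htq.trans (hq_le i h1 h2))
end

section
/- Let Ω ⊆ ℝ^d be a nonempty compact convex set and for t = 1,…,T let f_t : Ω → ℝ be continuous and G-Lipschitz with respect to ‖·‖₂ on Ω. Let w_1,…,w_T ∈ Ω be any learner sequence and u_1,…,u_T ∈ Ω any comparator sequence with path-length P_T = Σ_{t=1}^{T−1} ‖u_{t+1}−u_t‖₂. Then for every integer τ with 1 ≤ τ ≤ T, Σ_{t=1}^T f_t(w_t) − Σ_{t=1}^T f_t(u_t) ≤ ⌈T/τ⌉ · max_{1 ≤ τ' ≤ τ} SAReg(T,τ') + τ·G·P_T. -/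
/-- If every window of length at most `τ` satisfies a bound with additive constant `M`, then a
prefix of length `N` satisfies it with constant `⌈N/τ⌉ * M`. -/
theorem sum_Icc_le_of_block_le {T τ : ℕ} (hτ : 1 ≤ τ) {g a : ℕ → ℝ} {M : ℝ}
    (ha : ∀ t, 1 ≤ t → t < T → 0 ≤ a t)
    (hblock : ∀ s e, 1 ≤ s → s ≤ e → e ≤ T → e + 1 ≤ s + τ →
      ∑ t ∈ Finset.Icc s e, g t ≤ M + τ * ∑ t ∈ Finset.Ico s e, a t)
    (N : ℕ) (hN : N ≤ T) :
    ∑ t ∈ Finset.Icc 1 N, g t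
      ≤ (((N + τ - 1) / τ : ℕ) : ℝ) * M + τ * ∑ t ∈ Finset.Ico 1 N, a t := by
  induction N using Nat.strong_induction_on with
  | _ N ih =>
    rcases Nat.eq_zero_or_pos N with rfl | hpos
    · simp [Nat.div_eq_of_lt (show τ - 1 < τ by omega)]
    rcases le_or_gt N τ with hle | hlt
    · have hdiv : (N + τ - 1) / τ = 1 := by
        rw [show N + τ - 1 = (N - 1) + τ by omega, Nat.add_div_right _ (by omega),
          Nat.div_eq_of_lt (by omega)]
      rw [hdiv, Nat.cast_one, one_mul]
      exact hblock 1 N le_rfl hpos hN (by omega)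
    · obtain ⟨K, rfl⟩ : ∃ K, N = K + τ := ⟨N - τ, by omega⟩
      have hprefix := ih K (by omega) (by omega)
      have hlast := hblock (K + 1) (K + τ) (by omega) (by omega) hN (by omega)
      have hdiv : (K + τ + τ - 1) / τ = (K + τ - 1) / τ + 1 := by
        rw [show K + τ + τ - 1 = (K + τ - 1) + τ by omega, Nat.add_div_right _ (by omega)]
      have hg : ∑ t ∈ Finset.Icc 1 (K + τ), g t
          = ∑ t ∈ Finset.Icc 1 K, g t + ∑ t ∈ Finset.Icc (K + 1) (K + τ), g t := by
        simp only [← Finset.Ico_add_one_right_eq_Icc]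
        exact (Finset.sum_Ico_consecutive g (by omega) (by omega)).symm
      have hsplit : ∑ t ∈ Finset.Ico 1 K, a t + ∑ t ∈ Finset.Ico (K + 1) (K + τ), a t
          ≤ ∑ t ∈ Finset.Ico 1 (K + τ), a t := by
        rw [← Finset.sum_union]
        · refine Finset.sum_le_sum_of_subset_of_nonneg ?_ fun t ht _ => ?_
          · intro t ht
            simp only [Finset.mem_union, Finset.mem_Ico] at ht ⊢
            omega
          · rw [Finset.mem_Ico] at ht
            exact ha t ht.1 (by omega)
        · rw [Finset.disjoint_left]
          intro t h₁ h₂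
          rw [Finset.mem_Ico] at h₁ h₂
          omega
      have hmul := mul_le_mul_of_nonneg_left hsplit (Nat.cast_nonneg (α := ℝ) τ)
      rw [hg, hdiv]
      push_cast
      linarith

/-- The regret on `[s, s+τ-1]` against any fixed point of `Ω` is at most `SAReg Ω f w T τ`. -/
theorem regret_le_SAReg {d : ℕ} {Ω : Set (EuclideanSpace ℝ (Fin d))}
    (hcomp : IsCompact Ω) {f : ℕ → EuclideanSpace ℝ (Fin d) → ℝ}
    (hcont : ∀ t, ContinuousOn (f t) Ω) (w : ℕ → EuclideanSpace ℝ (Fin d))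
    {T τ s : ℕ} (hs : 1 ≤ s) (hsT : s + τ - 1 ≤ T)
    {v : EuclideanSpace ℝ (Fin d)} (hv : v ∈ Ω) :
    ∑ t ∈ Finset.Icc s (s + τ - 1), f t (w t) - ∑ t ∈ Finset.Icc s (s + τ - 1), f t v
      ≤ SAReg Ω f w T τ := by
  have hinf : sInf ((fun v => ∑ t ∈ Finset.Icc s (s + τ - 1), f t v) '' Ω)
      ≤ ∑ t ∈ Finset.Icc s (s + τ - 1), f t v :=
    csInf_le (hcomp.bddBelow_image (continuousOn_finsetSum _ fun t _ => hcont t))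
      (Set.mem_image_of_mem _ hv)
  refine (sub_le_sub_left hinf _).trans (le_csSup ?_ ⟨s, hs, hsT, rfl⟩)
  refine Set.Finite.bddAbove (((Set.finite_Iic (T + 1)).image fun s =>
    (∑ t ∈ Finset.Icc s (s + τ - 1), f t (w t)) -
      sInf ((fun v => ∑ t ∈ Finset.Icc s (s + τ - 1), f t v) '' Ω)).subset ?_)
  rintro r ⟨s', -, hs'T, rfl⟩
  exact ⟨s', Set.mem_Iic.mpr (by omega), rfl⟩

/-- The variation of a Lipschitz function along a sequence is at most the Lipschitz constant times
the path-length. -/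
theorem sub_le_sum_Ico_of_lipschitz {E : Type*} [SeminormedAddCommGroup E] {Ω : Set E} {G : ℝ}
    {φ : E → ℝ} (hlip : ∀ x ∈ Ω, ∀ y ∈ Ω, |φ x - φ y| ≤ G * ‖x - y‖) {u : ℕ → E} {s t : ℕ}
    (hst : s ≤ t) (hu : ∀ i, s ≤ i → i ≤ t → u i ∈ Ω) :
    φ (u s) - φ (u t) ≤ ∑ i ∈ Finset.Ico s t, G * ‖u (i + 1) - u i‖ := by
  have htele : φ (u s) - φ (u t) = ∑ i ∈ Finset.Ico s t, (φ (u i) - φ (u (i + 1))) := by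
    have h := Finset.sum_Ico_sub (fun i => φ (u i)) hst
    rw [← neg_sub, ← h, ← Finset.sum_neg_distrib]
    simp
  rw [htele]
  refine Finset.sum_le_sum fun i hi => ?_
  rw [Finset.mem_Ico] at hi
  rw [norm_sub_rev]
  exact (le_abs_self _).trans
    (hlip _ (hu i hi.1 hi.2.le) _ (hu (i + 1) (by omega) (by omega)))

/-- partitioning `[1,T]` into `⌈T/τ⌉` consecutive blocks of length at
most `τ` yields the dynamic-regret bound
`⌈T/τ⌉ · max_{1 ≤ τ' ≤ τ} SAReg(T,τ') + τ·G·P_T`.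
(`(T + τ - 1) / τ` is the natural-number ceiling `⌈T/τ⌉`.) -/
theorem dynamic_regret_block_bound
    (d T τ : ℕ) (hT : 1 ≤ T) (hτ1 : 1 ≤ τ) (hτT : τ ≤ T) (G : ℝ)
    (Ω : Set (EuclideanSpace ℝ (Fin d)))
    (hne : Ω.Nonempty) (hcomp : IsCompact Ω) (hconv : Convex ℝ Ω)
    (f : ℕ → EuclideanSpace ℝ (Fin d) → ℝ)
    (hcont : ∀ t, ContinuousOn (f t) Ω)
    (hlip : ∀ t, ∀ x ∈ Ω, ∀ y ∈ Ω, |f t x - f t y| ≤ G * ‖x - y‖)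
    (w u : ℕ → EuclideanSpace ℝ (Fin d))
    (hw : ∀ t, 1 ≤ t → t ≤ T → w t ∈ Ω)
    (hu : ∀ t, 1 ≤ t → t ≤ T → u t ∈ Ω) :
    ∑ t ∈ Finset.Icc 1 T, f t (w t) - ∑ t ∈ Finset.Icc 1 T, f t (u t)
      ≤ (((T + τ - 1) / τ : ℕ) : ℝ) *
          ((Finset.Icc 1 τ).sup' (Finset.nonempty_Icc.mpr hτ1)
            fun τ' => SAReg Ω f w T τ')
        + (τ : ℝ) * G * ∑ t ∈ Finset.Ico 1 T, ‖u (t + 1) - u t‖ := by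
  have ha : ∀ t, 1 ≤ t → t < T → 0 ≤ G * ‖u (t + 1) - u t‖ := fun t h₁ h₂ =>
    (abs_nonneg _).trans (hlip t _ (hu (t + 1) (by omega) (by omega)) _ (hu t h₁ h₂.le))
  rw [← Finset.sum_sub_distrib, mul_assoc, Finset.mul_sum]
  refine sum_Icc_le_of_block_le hτ1 ha (fun s e hs hse he hlen => ?_) T le_rfl
  have hend : s + (e + 1 - s) - 1 = e := by omega
  have hreg := regret_le_SAReg hcomp hcont w (T := T) (τ := e + 1 - s) hs (by omega)
    (hu s hs (hse.trans he))
  rw [hend] at hreg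
  have hmax := Finset.le_sup' (fun τ' => SAReg Ω f w T τ')
    (Finset.mem_Icc.mpr (show 1 ≤ e + 1 - s ∧ e + 1 - s ≤ τ by omega))
  set A := ∑ i ∈ Finset.Ico s e, G * ‖u (i + 1) - u i‖
  have hnonneg : ∀ i ∈ Finset.Ico s e, 0 ≤ G * ‖u (i + 1) - u i‖ := fun i hi => by
    rw [Finset.mem_Ico] at hi
    exact ha i (by omega) (by omega)
  have hdrift : ∑ t ∈ Finset.Icc s e, (f t (u s) - f t (u t)) ≤ τ * A := by
    have hterm : ∀ t ∈ Finset.Icc s e, f t (u s) - f t (u t) ≤ A := fun t ht => by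
      rw [Finset.mem_Icc] at ht
      exact (sub_le_sum_Ico_of_lipschitz (hlip t) ht.1 fun i h₁ h₂ =>
        hu i (by omega) (by omega)).trans (Finset.sum_le_sum_of_subset_of_nonneg
          (Finset.Ico_subset_Ico_right ht.2) fun i hi _ => hnonneg i hi)
    refine (Finset.sum_le_card_nsmul _ _ A hterm).trans ?_
    rw [nsmul_eq_mul, Nat.card_Icc]
    exact mul_le_mul_of_nonneg_right (by exact_mod_cast (by omega : e + 1 - s ≤ τ))
      (Finset.sum_nonneg hnonneg)
  rw [Finset.sum_sub_distrib] at hdrift ⊢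
  linarith
end

section
/- Let Ω ⊆ ℝ^d be a nonempty compact convex set with diameter at most D, T ≥ 2, and for t = 1,…,T let f_t : Ω → ℝ be continuous and G-Lipschitz with respect to ‖·‖₂ on Ω. Let w_1,…,w_T ∈ Ω be a learner sequence whose strongly adaptive regret satisfies SAReg(T,τ) ≤ (c + 8√(7 log T))·√τ for every integer 1 ≤ τ ≤ T, where c = 4DG/(√2−1) + 8√5. Then for any comparator sequence u_1,…,u_T ∈ Ω with path-length P_T = Σ_{t=1}^{T−1} ‖u_{t+1}−u_t‖₂, Σ_{t=1}^T f_t(w_t) − Σ_{t=1}^T f_t(u_t) ≤ 4·max{ (c + 8√(7 log T) + GD√(log T))·√T , (c + 8√(7 log T))·T^{2/3}·P_T^{1/3}/(D^{1/3}·(log T)^{1/6}) + G·D^{2/3}·T^{2/3}·P_T^{1/3}·(log T)^{1/3} }. -/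
open Finset in
/-- A bound on the strongly adaptive regret controls the static regret on every interval. -/
theorem sum_sub_le_of_SAReg_le {d T τ s : ℕ} {B : ℝ} {Ω : Set (EuclideanSpace ℝ (Fin d))}
    {f : ℕ → EuclideanSpace ℝ (Fin d) → ℝ} {w : ℕ → EuclideanSpace ℝ (Fin d)}
    (hcomp : IsCompact Ω) (hcont : ∀ t, ContinuousOn (f t) Ω) (hB : SAReg Ω f w T τ ≤ B)
    (hτ : 1 ≤ τ) (hs : 1 ≤ s) (hsT : s + τ ≤ T + 1) {v : EuclideanSpace ℝ (Fin d)} (hv : v ∈ Ω) :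
    ∑ t ∈ Ico s (s + τ), (f t (w t) - f t v) ≤ B := by
  have hI : Icc s (s + τ - 1) = Ico s (s + τ) := by
    ext t
    simp only [mem_Icc, mem_Ico]
    omega
  have hbelow : BddBelow ((fun v => ∑ t ∈ Icc s (s + τ - 1), f t v) '' Ω) :=
    (hcomp.image_of_continuousOn (continuousOn_finsetSum _ fun t _ => hcont t)).bddBelow
  have hInf := csInf_le hbelow (Set.mem_image_of_mem _ hv)
  have habove : BddAbove { r : ℝ | ∃ s : ℕ, 1 ≤ s ∧ s + τ - 1 ≤ T ∧
      r = (∑ t ∈ Icc s (s + τ - 1), f t (w t)) -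
        sInf ((fun v => ∑ t ∈ Icc s (s + τ - 1), f t v) '' Ω) } := by
    refine (((Set.finite_Iic (T + 1)).image fun s : ℕ =>
      (∑ t ∈ Icc s (s + τ - 1), f t (w t)) -
        sInf ((fun v => ∑ t ∈ Icc s (s + τ - 1), f t v) '' Ω)).subset ?_).bddAbove
    rintro r ⟨s, -, hs, rfl⟩
    exact ⟨s, by simp only [Set.mem_Iic]; omega, rfl⟩
  have hSup := (le_csSup habove ⟨s, hs, by omega, rfl⟩).trans hB
  rw [sum_sub_distrib, ← hI]
  linarith

open Finset in
/-- The dynamic regret on an interval is at most its static regret against the first comparator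
plus a multiple of the path length. -/
theorem sum_sub_le_add_path_length {d s n : ℕ} {G B : ℝ} {Ω : Set (EuclideanSpace ℝ (Fin d))}
    {f : ℕ → EuclideanSpace ℝ (Fin d) → ℝ} {w u : ℕ → EuclideanSpace ℝ (Fin d)}
    (hG : 0 ≤ G) (hlip : ∀ t, ∀ x ∈ Ω, ∀ y ∈ Ω, |f t x - f t y| ≤ G * ‖x - y‖)
    (hu : ∀ t ∈ Ico s (s + n), u t ∈ Ω)
    (hstatic : ∑ t ∈ Ico s (s + n), (f t (w t) - f t (u s)) ≤ B) :
    ∑ t ∈ Ico s (s + n), (f t (w t) - f t (u t))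
      ≤ B + G * n * ∑ t ∈ Ico s (s + n - 1), ‖u (t + 1) - u t‖ := by
  have hdrift : ∑ t ∈ Ico s (s + n), (f t (u s) - f t (u t))
      ≤ ∑ _t ∈ Ico s (s + n), G * ∑ i ∈ Ico s (s + n - 1), ‖u (i + 1) - u i‖ := by
    refine sum_le_sum fun t ht => ?_
    have ht' := mem_Ico.1 ht
    refine (le_abs_self _).trans
      ((hlip t _ (hu s (mem_Ico.2 (by omega))) _ (hu t ht)).trans ?_)
    refine mul_le_mul_of_nonneg_left ?_ hG
    rw [← dist_eq_norm]
    refine (dist_le_Ico_sum_dist u ht'.1).trans ?_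
    simp only [dist_eq_norm, norm_sub_rev (u _) (u (_ + 1))]
    exact sum_le_sum_of_subset_of_nonneg (Ico_subset_Ico le_rfl (by omega))
      fun _ _ _ => norm_nonneg _
  have hsplit : ∑ t ∈ Ico s (s + n), (f t (w t) - f t (u t))
      = ∑ t ∈ Ico s (s + n), (f t (w t) - f t (u s))
        + ∑ t ∈ Ico s (s + n), (f t (u s) - f t (u t)) := by
    rw [← sum_add_distrib]
    exact sum_congr rfl fun _ _ => by ring
  rw [sum_const, Nat.card_Ico, Nat.add_sub_cancel_left, nsmul_eq_mul] at hdrift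
  rw [hsplit]
  linarith

open Finset in
/-- Cutting `[1, N]` into blocks of length `τ` bounds the dynamic regret when static regret is
controlled on every interval of length at most `τ`. -/
theorem dynamic_regret_le_of_block_length {d T τ : ℕ} {G K : ℝ}
    {Ω : Set (EuclideanSpace ℝ (Fin d))}
    {f : ℕ → EuclideanSpace ℝ (Fin d) → ℝ} {w u : ℕ → EuclideanSpace ℝ (Fin d)}
    (hG : 0 ≤ G) (hK : 0 ≤ K) (hτ : 1 ≤ τ)
    (hlip : ∀ t, ∀ x ∈ Ω, ∀ y ∈ Ω, |f t x - f t y| ≤ G * ‖x - y‖)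
    (hu : ∀ t, 1 ≤ t → t ≤ T → u t ∈ Ω)
    (hstatic : ∀ s n, 1 ≤ s → 1 ≤ n → n ≤ τ → s + n ≤ T + 1 → ∀ v ∈ Ω,
      ∑ t ∈ Ico s (s + n), (f t (w t) - f t v) ≤ K * √n) (N : ℕ) (hN : N ≤ T) :
    ∑ t ∈ Ico 1 (1 + N), (f t (w t) - f t (u t))
      ≤ K * √τ * (N / τ + 1) + G * τ * ∑ t ∈ Ico 1 N, ‖u (t + 1) - u t‖ := by
  have hτ0 : (0 : ℝ) < τ := by exact_mod_cast hτ
  have hblock : ∀ s n, 1 ≤ s → 1 ≤ n → n ≤ τ → s + n ≤ T + 1 →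
      ∑ t ∈ Ico s (s + n), (f t (w t) - f t (u t))
        ≤ K * √τ + G * τ * ∑ t ∈ Ico s (s + n - 1), ‖u (t + 1) - u t‖ := by
    intro s n hs hn hnτ hsn
    refine (sum_sub_le_add_path_length hG hlip
      (fun t ht => hu t (by have := mem_Ico.1 ht; omega) (by have := mem_Ico.1 ht; omega))
      (hstatic s n hs hn hnτ hsn (u s) (hu s hs (by omega)))).trans ?_
    have hpath : 0 ≤ ∑ t ∈ Ico s (s + n - 1), ‖u (t + 1) - u t‖ :=
      sum_nonneg fun _ _ => norm_nonneg _
    have hcast : (n : ℝ) ≤ τ := by exact_mod_cast hnτ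
    gcongr
  induction N using Nat.strong_induction_on with
  | _ N ih =>
    rcases Nat.eq_zero_or_pos N with rfl | hpos
    · simp only [add_zero, Ico_self, sum_empty, CharP.cast_eq_zero, zero_div]
      have : Ico 1 0 = ∅ := by simp
      rw [this]
      simp only [sum_empty, mul_zero]
      positivity
    rcases le_or_gt N τ with hle | hlt
    · refine (hblock 1 N le_rfl hpos hle (by omega)).trans ?_
      rw [Nat.add_sub_cancel_left]
      have : 0 ≤ K * √τ * (N / τ) := by positivity
      linarith
    · obtain ⟨M, rfl⟩ := Nat.exists_eq_add_of_le' hlt.le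
      have hM := ih M (by omega) (by omega)
      have hlast := hblock (1 + M) τ (by omega) hτ le_rfl (by omega)
      have hpath : ∑ t ∈ Ico 1 M, ‖u (t + 1) - u t‖
          + ∑ t ∈ Ico (1 + M) (1 + M + τ - 1), ‖u (t + 1) - u t‖
          ≤ ∑ t ∈ Ico 1 (M + τ), ‖u (t + 1) - u t‖ := by
        rw [← sum_union (by
          rw [disjoint_left]
          intro a ha hb
          have := mem_Ico.1 ha
          have := mem_Ico.1 hb
          omega)]
        refine sum_le_sum_of_subset_of_nonneg (fun a ha => ?_) fun _ _ _ => norm_nonneg _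
        simp only [mem_union, mem_Ico] at ha ⊢
        omega
      rw [← add_assoc,
        ← sum_Ico_consecutive _ (by omega : 1 ≤ 1 + M) (by omega : 1 + M ≤ 1 + M + τ)]
      have hcast : ((M + τ : ℕ) : ℝ) / τ = M / τ + 1 := by
        push_cast
        field_simp
      rw [hcast]
      have := mul_le_mul_of_nonneg_left hpath (by positivity : 0 ≤ G * τ)
      linarith

/-- The block length `⌈(δ a l / p)²⌉` balances the two terms of the blocked regret bound. -/
theorem exists_balanced_block_length {T : ℕ} {K G a p δ l : ℝ} (hK : 0 ≤ K) (hG : 0 ≤ G)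
    (ha : 0 < a) (hp : 0 < p) (hδ : 0 < δ) (hl : 0 < l) (haT : a ^ 3 = T)
    (hl6 : 1 / 27 ≤ l ^ 6) (hpδ : p ≤ δ * a) (hlarge : δ ^ 6 * l ^ 6 ≤ p ^ 6 * a ^ 3) :
    ∃ τ : ℕ, 1 ≤ τ ∧ τ ≤ T ∧ K * √τ * (T / τ + 1) + G * τ * p ^ 3
      ≤ 4 * (K * a ^ 2 * p / (δ * l) + G * δ ^ 2 * a ^ 2 * p * l ^ 2) := by
  have hx0 : 0 < δ * a * l / p := by positivity
  set x := δ * a * l / p with hx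
  have hxT : x ^ 2 ≤ T := by
    rw [← haT]
    refine le_of_pow_le_pow_left₀ (n := 3) (by norm_num) (by positivity) ?_
    have : (x ^ 2) ^ 3 = δ ^ 6 * l ^ 6 * a ^ 6 / p ^ 6 := by
      rw [hx]
      field_simp
    rw [this, div_le_iff₀ (by positivity)]
    nlinarith [mul_le_mul_of_nonneg_right hlarge (by positivity : 0 ≤ a ^ 6)]
  have hlx : l ≤ x := by
    rw [hx, le_div_iff₀ hp]
    nlinarith
  have hx3 : 1 / 3 ≤ x ^ 2 := by
    refine le_of_pow_le_pow_left₀ (n := 3) (by norm_num) (by positivity) ?_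
    have : l ^ 6 ≤ x ^ 6 := by gcongr
    nlinarith
  have hceil : x ^ 2 ≤ ⌈x ^ 2⌉₊ := Nat.le_ceil _
  have hceil' : (⌈x ^ 2⌉₊ : ℝ) < x ^ 2 + 1 := Nat.ceil_lt_add_one (by positivity)
  have h1 : 1 ≤ ⌈x ^ 2⌉₊ := Nat.one_le_ceil_iff.2 (by positivity)
  have h2 : ⌈x ^ 2⌉₊ ≤ T := Nat.ceil_le.2 hxT
  refine ⟨⌈x ^ 2⌉₊, h1, h2, ?_⟩
  generalize ⌈x ^ 2⌉₊ = τ at *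
  have hτ0 : (0 : ℝ) < τ := by exact_mod_cast h1
  have hsqrt : x ≤ √τ := Real.le_sqrt_of_sq_le hceil
  have hfirst : √τ * (T / τ + 1) ≤ 2 * (a ^ 2 * p / (δ * l)) := by
    have hdiv : 1 ≤ (T : ℝ) / τ := by
      rw [le_div_iff₀ hτ0, one_mul]
      exact_mod_cast h2
    have hsq : √(τ : ℝ) * √τ = τ := Real.mul_self_sqrt hτ0.le
    calc √τ * (T / τ + 1) ≤ √τ * (2 * (T / τ)) := by gcongr; linarith
      _ = 2 * (T / √τ) := by
        rw [eq_comm, ← mul_div_assoc, div_eq_iff (by positivity)]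
        field_simp
        linear_combination -(T : ℝ) * hsq
      _ ≤ 2 * (T / x) := by gcongr
      _ = 2 * (a ^ 2 * p / (δ * l)) := by
        rw [← haT, hx]
        field_simp
  have hsecond : τ * p ^ 3 ≤ 4 * (δ ^ 2 * a ^ 2 * p * l ^ 2) := by
    calc τ * p ^ 3 ≤ 4 * x ^ 2 * p ^ 3 := by gcongr; linarith
      _ = _ := by
        rw [hx]
        field_simp
  have h3 := mul_le_mul_of_nonneg_left hfirst hK
  have h4 := mul_le_mul_of_nonneg_left hsecond hG
  have h5 : 0 ≤ K * (a ^ 2 * p / (δ * l)) := by positivity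
  have h6 : K * a ^ 2 * p / (δ * l) = K * (a ^ 2 * p / (δ * l)) := by ring
  rw [h6]
  linarith

/-- the bound (10) of Theorem 1, with a factor 4 for integer rounding:
if the learner's strongly adaptive regret satisfies
`SAReg(T,τ) ≤ (c + 8√(7 log T))·√τ` for all `1 ≤ τ ≤ T` where
`c = 4DG/(√2−1) + 8√5`, then for any comparator sequence `u` with path-length
`P_T`, the dynamic regret is at most
`4·max{(c + 8√(7 log T) + GD√(log T))·√T,
       (c + 8√(7 log T))·T^{2/3}P_T^{1/3}/(D^{1/3}(log T)^{1/6})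
         + G·D^{2/3}·T^{2/3}·P_T^{1/3}·(log T)^{1/3}}`. -/
theorem dynamic_regret_from_adaptive_regret
    (d T : ℕ) (hT : 2 ≤ T) (D G : ℝ)
    (Ω : Set (EuclideanSpace ℝ (Fin d)))
    (hne : Ω.Nonempty) (hcomp : IsCompact Ω) (hconv : Convex ℝ Ω)
    (hdiam : ∀ x ∈ Ω, ∀ y ∈ Ω, ‖x - y‖ ≤ D)
    (f : ℕ → EuclideanSpace ℝ (Fin d) → ℝ)
    (hcont : ∀ t, ContinuousOn (f t) Ω)
    (hlip : ∀ t, ∀ x ∈ Ω, ∀ y ∈ Ω, |f t x - f t y| ≤ G * ‖x - y‖)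
    (w u : ℕ → EuclideanSpace ℝ (Fin d))
    (hw : ∀ t, 1 ≤ t → t ≤ T → w t ∈ Ω)
    (hu : ∀ t, 1 ≤ t → t ≤ T → u t ∈ Ω)
    (hSA : ∀ τ : ℕ, 1 ≤ τ → τ ≤ T →
      SAReg Ω f w T τ ≤
        (4 * D * G / (Real.sqrt 2 - 1) + 8 * Real.sqrt 5
          + 8 * Real.sqrt (7 * Real.log T)) * Real.sqrt τ)
    (P : ℝ) (hP : P = ∑ t ∈ Finset.Ico 1 T, ‖u (t + 1) - u t‖) :
    ∑ t ∈ Finset.Icc 1 T, f t (w t) - ∑ t ∈ Finset.Icc 1 T, f t (u t)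
      ≤ 4 * max
          ((4 * D * G / (Real.sqrt 2 - 1) + 8 * Real.sqrt 5
              + 8 * Real.sqrt (7 * Real.log T) + G * D * Real.sqrt (Real.log T))
            * Real.sqrt T)
          ((4 * D * G / (Real.sqrt 2 - 1) + 8 * Real.sqrt 5
              + 8 * Real.sqrt (7 * Real.log T))
              * (T : ℝ) ^ ((2 : ℝ) / 3) * P ^ ((1 : ℝ) / 3)
              / (D ^ ((1 : ℝ) / 3) * Real.log T ^ ((1 : ℝ) / 6))
            + G * D ^ ((2 : ℝ) / 3) * (T : ℝ) ^ ((2 : ℝ) / 3) * P ^ ((1 : ℝ) / 3)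
              * Real.log T ^ ((1 : ℝ) / 3)) := by
  generalize hKdef : 4 * D * G / (Real.sqrt 2 - 1) + 8 * Real.sqrt 5
    + 8 * Real.sqrt (7 * Real.log T) = K at *
  have hstatic : ∀ s n, 1 ≤ s → 1 ≤ n → s + n ≤ T + 1 → ∀ v ∈ Ω,
      ∑ t ∈ Finset.Ico s (s + n), (f t (w t) - f t v) ≤ K * √n := fun s n hs hn hsn v hv =>
    sum_sub_le_of_SAReg_le hcomp hcont (hSA n hn (by omega)) hn hs hsn hv
  have hK : 0 ≤ K := by
    simpa using hstatic 1 1 le_rfl le_rfl (by omega) (w 1) (hw 1 le_rfl (by omega))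
  have hIcc : Finset.Icc 1 T = Finset.Ico 1 (1 + T) := by
    ext t
    simp only [Finset.mem_Icc, Finset.mem_Ico]
    omega
  rw [← Finset.sum_sub_distrib, hIcc]
  rcases lt_or_ge G 0 with hG | hG
  · have hsub : ∀ x ∈ Ω, ∀ y ∈ Ω, x = y := by
      intro x hx y hy
      have h1 := (abs_nonneg _).trans (hlip 0 x hx y hy)
      have h2 : ‖x - y‖ ≤ 0 := by
        by_contra! h
        nlinarith
      exact sub_eq_zero.1 (norm_le_zero_iff.1 h2)
    have hP0 : P = 0 := by
      rw [hP]
      refine Finset.sum_eq_zero fun t ht => ?_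
      have ht' := Finset.mem_Ico.1 ht
      rw [hsub _ (hu (t + 1) (by omega) (by omega)) _ (hu t (by omega) (by omega)), sub_self,
        norm_zero]
    have hsum : ∑ t ∈ Finset.Ico 1 (1 + T), (f t (w t) - f t (u t)) = 0 := by
      refine Finset.sum_eq_zero fun t ht => ?_
      have ht' := Finset.mem_Ico.1 ht
      rw [hsub _ (hw t (by omega) (by omega)) _ (hu t (by omega) (by omega)), sub_self]
    rw [hsum, hP0, Real.zero_rpow (by norm_num)]
    simp
  have hD : 0 ≤ D := by
    obtain ⟨x, hx⟩ := hne
    exact (norm_nonneg _).trans (hdiam x hx x hx)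
  have hmain : ∀ τ : ℕ, 1 ≤ τ → ∑ t ∈ Finset.Ico 1 (1 + T), (f t (w t) - f t (u t))
      ≤ K * √τ * (T / τ + 1) + G * τ * P := by
    intro τ hτ
    rw [hP]
    exact dynamic_regret_le_of_block_length hG hK hτ hlip hu
      (fun s n hs hn _ hsn => hstatic s n hs hn hsn) T le_rfl
  have hT2 : (2 : ℝ) ≤ T := by exact_mod_cast hT
  have hT0 : (0 : ℝ) < T := by linarith
  have hL : 1 / 27 ≤ Real.log T := by
    have := Real.log_le_log (by norm_num) hT2
    have := Real.log_two_gt_d9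
    linarith
  have hL0 : 0 < Real.log T := by linarith
  have hP0 : 0 ≤ P := by
    rw [hP]
    exact Finset.sum_nonneg fun _ _ => norm_nonneg _
  rcases le_or_gt (P * √T) (D * √(Real.log T)) with hsmall | hbig
  · refine (hmain T (by omega)).trans ?_
    refine le_trans ?_ (mul_le_mul_of_nonneg_left (le_max_left _ _) (by norm_num))
    have hsq : √(T : ℝ) * √T = T := Real.mul_self_sqrt hT0.le
    have hdrift : G * T * P ≤ G * D * √(Real.log T) * √T := by
      calc G * T * P = G * √T * (P * √T) := by linear_combination -(G * P) * hsq
        _ ≤ G * √T * (D * √(Real.log T)) := by gcongr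
        _ = _ := by ring
    have h1 : 0 ≤ K * √T := by positivity
    have h2 : 0 ≤ G * D * √(Real.log T) * √T := by positivity
    rw [div_self hT0.ne']
    linarith
  · have hPT : P ≤ D * T := by
      rw [hP]
      refine (Finset.sum_le_card_nsmul _ _ D fun t ht => ?_).trans ?_
      · have ht' := Finset.mem_Ico.1 ht
        exact hdiam _ (hu (t + 1) (by omega) (by omega)) _ (hu t (by omega) (by omega))
      · rw [Nat.card_Ico, nsmul_eq_mul, mul_comm]
        gcongr
        omega
    have hPpos : 0 < P := by
      refine lt_of_le_of_ne hP0 fun h => ?_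
      rw [← h, zero_mul] at hbig
      exact absurd hbig (not_lt.2 (by positivity))
    have hDpos : 0 < D := by
      by_contra! h
      nlinarith
    have hroot : ∀ (y : ℝ) (n : ℕ), 0 ≤ y → n ≠ 0 → (y ^ ((1 : ℝ) / n)) ^ n = y := by
      intro y n hy hn
      rw [one_div, Real.rpow_inv_natCast_pow hy hn]
    have hsq : ∀ y : ℝ, 0 ≤ y → y ^ ((2 : ℝ) / 3) = (y ^ ((1 : ℝ) / 3)) ^ 2 := by
      intro y hy
      rw [← Real.rpow_natCast, ← Real.rpow_mul hy]
      norm_num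
    have hsq6 : Real.log T ^ ((1 : ℝ) / 3) = (Real.log T ^ ((1 : ℝ) / 6)) ^ 2 := by
      rw [← Real.rpow_natCast, ← Real.rpow_mul hL0.le]
      norm_num
    have haT := hroot T 3 hT0.le (by norm_num)
    have hp3 := hroot P 3 hP0 (by norm_num)
    have hδ3 := hroot D 3 hD (by norm_num)
    have hl6 := hroot (Real.log T) 6 hL0.le (by norm_num)
    push_cast at haT hp3 hδ3 hl6
    have ha := Real.rpow_pos_of_pos hT0 ((1 : ℝ) / 3)
    have hp := Real.rpow_pos_of_pos hPpos ((1 : ℝ) / 3)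
    have hδ := Real.rpow_pos_of_pos hDpos ((1 : ℝ) / 3)
    have hl := Real.rpow_pos_of_pos hL0 ((1 : ℝ) / 6)
    rw [hsq T hT0.le, hsq D hD, hsq6]
    generalize (T : ℝ) ^ ((1 : ℝ) / 3) = a at *
    generalize P ^ ((1 : ℝ) / 3) = p at *
    generalize D ^ ((1 : ℝ) / 3) = δ at *
    generalize Real.log T ^ ((1 : ℝ) / 6) = l at *
    have hpδ : p ≤ δ * a := by
      refine le_of_pow_le_pow_left₀ (n := 3) (by norm_num) (by positivity) ?_
      rw [mul_pow, hp3, hδ3, haT]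
      exact hPT
    have hlarge : δ ^ 6 * l ^ 6 ≤ p ^ 6 * a ^ 3 := by
      have h := pow_le_pow_left₀ (by positivity) hbig.le 2
      rw [mul_pow, mul_pow, Real.sq_sqrt hL0.le, Real.sq_sqrt hT0.le] at h
      calc δ ^ 6 * l ^ 6 = D ^ 2 * Real.log T := by rw [hl6, ← hδ3]; ring
        _ ≤ P ^ 2 * T := h
        _ = p ^ 6 * a ^ 3 := by rw [haT, ← hp3]; ring
    obtain ⟨τ, hτ1, -, hτ⟩ := exists_balanced_block_length hK hG ha hp hδ hl haT
      (hL.trans_eq hl6.symm) hpδ hlarge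
    refine (hmain τ hτ1).trans ?_
    rw [hp3] at hτ
    exact hτ.trans (mul_le_mul_of_nonneg_left (le_max_right _ _) (by norm_num))
end

section
/- Fix a positive integer T. Every interval [r,s] of positive integers with 1 ≤ r ≤ s ≤ T can be partitioned into two sequences of disjoint consecutive intervals I_{−p}, …, I_0 and I_1, …, I_q (whose union, in order, is [r,s]), all belonging to the dense geometric covering collection D, such that |I_{−i}|/|I_{−i+1}| ≤ 1/2 for all i ≥ 1 and |I_i|/|I_{i−1}| ≤ 1/2 for all i ≥ 2. -/
/-- `[a,b]` belongs to the dense geometric covering collection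
`D = ∪_{k ≥ 0, 2^k ≤ T} D_k`, where `D_k = {[(i−1)·2^k + 1, i·2^k] : i ≥ 1}`. -/
def IsDGC (T a b : ℕ) : Prop :=
  ∃ k i : ℕ, 1 ≤ i ∧ 2 ^ k ≤ T ∧ a = (i - 1) * 2 ^ k + 1 ∧ b = i * 2 ^ k

/-- `[u, v)` is a dyadic interval `[i * 2 ^ k, (i + 1) * 2 ^ k)`. -/
def IsDyadic (u v : ℕ) : Prop := ∃ k i : ℕ, u = i * 2 ^ k ∧ v = (i + 1) * 2 ^ k

theorem IsDyadic.lt {u v : ℕ} (h : IsDyadic u v) : u < v := by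
  obtain ⟨k, i, rfl, rfl⟩ := h
  exact Nat.mul_lt_mul_of_pos_right (Nat.lt_succ_self i) (by positivity)

theorem isDyadic_succ (u : ℕ) : IsDyadic u (u + 1) := ⟨0, u, by simp, by simp⟩

theorem IsDyadic.two_mul {u v : ℕ} (h : IsDyadic u v) : IsDyadic (2 * u) (2 * v) := by
  obtain ⟨k, i, rfl, rfl⟩ := h
  exact ⟨k + 1, i, by ring, by ring⟩

theorem IsDyadic.isDGC {T u v : ℕ} (h : IsDyadic u v) (hv : v ≤ T) : IsDGC T (u + 1) v := by
  obtain ⟨k, i, rfl, rfl⟩ := h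
  exact ⟨k, i + 1, by omega, (Nat.le_mul_of_pos_left _ i.succ_pos).trans hv, by simp, rfl⟩

/-- The breakpoints `c 0 < ⋯ < c (n + 1)` cut `[x, y)` into dyadic intervals whose lengths
at least double up to index `p` and at least halve from index `p + 1` on. -/
structure IsDyadicPartition (n p : ℕ) (c : ℕ → ℕ) (x y : ℕ) : Prop where
  le : p ≤ n
  left : c 0 = x
  right : c (n + 1) = y
  dyadic : ∀ m ≤ n, IsDyadic (c m) (c (m + 1))
  bound : ∀ m ≤ n, c (m + 1) ≤ y
  doubling : ∀ m < p, 2 * (c (m + 1) - c m) ≤ c (m + 2) - c (m + 1)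
  halving : ∀ m, p < m → m < n → 2 * (c (m + 2) - c (m + 1)) ≤ c (m + 1) - c m

namespace IsDyadicPartition

variable {n p : ℕ} {c : ℕ → ℕ} {x y : ℕ}

theorem two_mul (h : IsDyadicPartition n p c x y) :
    IsDyadicPartition n p (fun m => 2 * c m) (2 * x) (2 * y) where
  le := h.le
  left := by rw [h.left]
  right := by rw [h.right]
  dyadic m hm := (h.dyadic m hm).two_mul
  bound m hm := Nat.mul_le_mul_left 2 (h.bound m hm)
  doubling m hm := by have := h.doubling m hm; omega
  halving m hm hn := by have := h.halving m hm hn; omega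

theorem prepend (h : IsDyadicPartition n p c (x + 1) y) (hc : 2 ≤ c 1 - c 0) :
    IsDyadicPartition (n + 1) (p + 1) (fun m => m.casesOn x c) x y where
  le := Nat.succ_le_succ h.le
  left := rfl
  right := h.right
  dyadic
    | 0, _ => by
      change IsDyadic x (c 0)
      exact h.left ▸ isDyadic_succ x
    | m + 1, hm => h.dyadic m (by omega)
  bound
    | 0, _ => by
      have h1 : c 1 ≤ y := h.bound 0 (Nat.zero_le n)
      change c 0 ≤ y
      omega
    | m + 1, hm => h.bound m (by omega)
  doubling
    | 0, _ => by
      have := h.left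
      change 2 * (c 0 - x) ≤ c 1 - c 0
      omega
    | m + 1, hm => h.doubling m (by omega)
  halving
    | 0, hm, _ => by omega
    | m + 1, hm, hn => h.halving m (by omega) (by omega)

theorem append (h : IsDyadicPartition n p c x y) (hc : 2 ≤ c (n + 1) - c n) :
    IsDyadicPartition (n + 1) p (fun m => if m ≤ n + 1 then c m else y + 1) x (y + 1) where
  le := h.le.trans n.le_succ
  left := by simp [h.left]
  right := by simp
  dyadic m hm := by
    rcases hm.lt_or_eq with hm | rfl
    · simpa [show m ≤ n + 1 by omega, show m ≤ n by omega] using h.dyadic m (by omega)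
    · simpa [h.right] using isDyadic_succ y
  bound m hm := by
    rcases hm.lt_or_eq with hm | rfl
    · simpa [show m ≤ n by omega] using (h.bound m (by omega)).trans y.le_succ
    · simp
  doubling m hm := by
    have := h.le
    simpa [show m ≤ n + 1 by omega, show m ≤ n by omega, show m + 1 ≤ n by omega]
      using h.doubling m hm
  halving m hm hn := by
    rcases (Nat.lt_succ_iff.mp hn).lt_or_eq with hn | rfl
    · simpa [show m ≤ n + 1 by omega, show m ≤ n by omega, show m + 1 ≤ n by omega]
        using h.halving m hm hn
    · have := h.right
      simp
      omega

theorem single (x : ℕ) : IsDyadicPartition 0 0 (fun m => x + m) x (x + 1) where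
  le := le_rfl
  left := rfl
  right := rfl
  dyadic m _ := isDyadic_succ (x + m)
  bound m hm := by omega
  doubling m hm := by omega
  halving m _ hn := by omega

theorem pair (x : ℕ) : IsDyadicPartition 1 0 (fun m => x + m) x (x + 2) where
  le := Nat.zero_le 1
  left := rfl
  right := rfl
  dyadic m _ := isDyadic_succ (x + m)
  bound m hm := by omega
  doubling m hm := by omega
  halving m _ hn := by omega

end IsDyadicPartition

theorem exists_isDyadicPartition (x y : ℕ) (hxy : x < y) :
    ∃ n p c, IsDyadicPartition n p c x y := by
  induction y using Nat.strong_induction_on generalizing x with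
  | _ y ih =>
    by_cases hlt : (x + 1) / 2 < y / 2
    · obtain ⟨n, p, c, h⟩ := ih (y / 2) (by omega) ((x + 1) / 2) hlt
      have hlen : ∀ m ≤ n, 2 ≤ 2 * c (m + 1) - 2 * c m := fun m hm => by
        have := (h.dyadic m hm).lt
        omega
      obtain ⟨n₁, p₁, c₁, h₁, hc₁⟩ : ∃ n₁ p₁ c₁,
          IsDyadicPartition n₁ p₁ c₁ (2 * ((x + 1) / 2)) y ∧ 2 ≤ c₁ 1 - c₁ 0 := by
        rcases Nat.even_or_odd' y with ⟨z, hz | hz⟩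
        · have hy : 2 * (y / 2) = y := by omega
          exact ⟨n, p, _, hy ▸ h.two_mul, hlen 0 (Nat.zero_le n)⟩
        · have hy : 2 * (y / 2) + 1 = y := by omega
          exact ⟨n + 1, p, _, hy ▸ h.two_mul.append (hlen n le_rfl),
            by simpa using hlen 0 (Nat.zero_le n)⟩
      rcases Nat.even_or_odd' x with ⟨z, hz | hz⟩
      · have hx : 2 * ((x + 1) / 2) = x := by omega
        exact ⟨n₁, p₁, c₁, hx ▸ h₁⟩
      · have hx : 2 * ((x + 1) / 2) = x + 1 := by omega
        exact ⟨n₁ + 1, p₁ + 1, _, (hx ▸ h₁).prepend hc₁⟩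
    · obtain rfl | rfl : y = x + 1 ∨ y = x + 2 := by omega
      · exact ⟨0, 0, _, .single x⟩
      · exact ⟨1, 0, _, .pair x⟩

/-- Lemma 3: every interval `[r,s] ⊆ [1,T]` can be partitioned into
consecutive intervals `I₀ = [a 0, b 0], …, I_n = [a n, b n]` from the dense geometric
covering collection, where the first `p+1` of them play the role of `I_{−p},…,I_0`
and the rest of `I_1,…,I_q`; the lengths at least double along `I_{−p},…,I_0`
(`2·|I_{−i}| ≤ |I_{−i+1}|` for `i ≥ 1`) and at least halve along `I_1,…,I_q`
(`2·|I_i| ≤ |I_{i−1}|` for `i ≥ 2`). -/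
theorem dgc_partition (T r s : ℕ) (hr : 1 ≤ r) (hrs : r ≤ s) (hsT : s ≤ T) :
    ∃ (n p : ℕ) (a b : ℕ → ℕ), p ≤ n ∧ a 0 = r ∧ b n = s ∧
      (∀ m, m ≤ n → IsDGC T (a m) (b m)) ∧
      (∀ m, m < n → a (m + 1) = b m + 1) ∧
      (∀ m, m + 1 ≤ p → 2 * (b m - a m + 1) ≤ b (m + 1) - a (m + 1) + 1) ∧
      (∀ m, p + 1 ≤ m → m < n → 2 * (b (m + 1) - a (m + 1) + 1) ≤ b m - a m + 1) := by
  obtain ⟨n, p, c, h⟩ := exists_isDyadicPartition (r - 1) s (by omega)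
  have hlt : ∀ m ≤ n, c m < c (m + 1) := fun m hm => (h.dyadic m hm).lt
  refine ⟨n, p, fun m => c m + 1, fun m => c (m + 1), h.le, ?_, h.right,
    fun m hm => (h.dyadic m hm).isDGC ((h.bound m hm).trans hsT), fun m _ => rfl, ?_, ?_⟩
  · have := h.left
    dsimp only
    omega
  · intro m hm
    have hle := h.le
    have h1 := hlt m (by omega)
    have h2 : c (m + 1) < c (m + 2) := hlt (m + 1) (by omega)
    have h3 := h.doubling m (by omega)
    change 2 * (c (m + 1) - (c m + 1) + 1) ≤ c (m + 2) - (c (m + 1) + 1) + 1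
    omega
  · intro m hm hn
    have h1 := hlt m (by omega)
    have h2 : c (m + 1) < c (m + 2) := hlt (m + 1) (by omega)
    have h3 := h.halving m (by omega) hn
    change 2 * (c (m + 2) - (c (m + 1) + 1) + 1) ≤ c (m + 1) - (c m + 1) + 1
    omega
end

section
/- Every interval [r,s] of positive integers with 1 ≤ r ≤ s can be partitioned into two sequences of disjoint consecutive intervals I_{−p}, …, I_0 and I_1, …, I_q (whose union, in order, is [r,s]), all belonging to the geometric covering collection 𝓘, such that |I_{−i}|/|I_{−i+1}| ≤ 1/2 for all i ≥ 1 and |I_i|/|I_{i−1}| ≤ 1/2 for all i ≥ 2. -/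
/-- `[a,b]` belongs to the geometric covering collection `𝓘 = ∪_{k ≥ 0} 𝓘_k`
of Daniely et al., where `𝓘_k = {[i·2^k, (i+1)·2^k − 1] : i ≥ 1}`. -/
def IsGC (a b : ℕ) : Prop :=
  ∃ k i : ℕ, 1 ≤ i ∧ a = i * 2 ^ k ∧ b = (i + 1) * 2 ^ k - 1

/-- `c 0 = r < c 1 < ⋯ < c (n + 1) = t` cuts `[r, t)` into dyadic blocks `[c m, c m + 2 ^ e m)`,
the exponents `e` increasing strictly up to index `p` and decreasing strictly from `p + 1` on. -/
structure IsDyadicChain (r t n p : ℕ) (c e : ℕ → ℕ) : Prop where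
  le : p ≤ n
  first : c 0 = r
  last : c (n + 1) = t
  pos : 1 ≤ r
  dvd : ∀ m, m ≤ n → 2 ^ e m ∣ c m
  step : ∀ m, m ≤ n → c (m + 1) = c m + 2 ^ e m
  incr : ∀ m, m + 1 ≤ p → e m < e (m + 1)
  decr : ∀ m, p + 1 ≤ m → m < n → e (m + 1) < e m

namespace IsDyadicChain

variable {r t n p : ℕ} {c e : ℕ → ℕ}

theorem singleton (hr : 1 ≤ r) : IsDyadicChain r (r + 1) 0 0 (fun m => r + m) (fun _ => 0) where
  le := le_rfl
  first := rfl
  last := rfl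
  pos := hr
  dvd _ _ := by simp
  step m _ := by simp [add_assoc]
  incr m h := by omega
  decr m _ h := by omega

theorem double (h : IsDyadicChain r t n p c e) :
    IsDyadicChain (2 * r) (2 * t) n p (fun m => 2 * c m) (fun m => e m + 1) where
  le := h.le
  first := by simp [h.first]
  last := by simp [h.last]
  pos := by have := h.pos; omega
  dvd m hm := by
    rw [pow_succ']
    exact mul_dvd_mul_left 2 (h.dvd m hm)
  step m hm := by simp only [h.step m hm]; ring
  incr m hm := by have := h.incr m hm; omega
  decr m hp hm := by have := h.decr m hp hm; omega

theorem cons (h : IsDyadicChain (r + 1) t n p c e) (hr : 1 ≤ r) (he : 1 ≤ e 0) :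
    IsDyadicChain r t (n + 1) (p + 1) (fun m => m.casesOn r c) (fun m => m.casesOn 0 e) where
  le := by have := h.le; omega
  first := rfl
  last := h.last
  pos := hr
  dvd m hm := by
    cases m with
    | zero => simp
    | succ m => exact h.dvd m (by omega)
  step m hm := by
    cases m with
    | zero => simpa using h.first
    | succ m => exact h.step m (by omega)
  incr m hm := by
    cases m with
    | zero => exact he
    | succ m => exact h.incr m (by omega)
  decr m hp hm := by
    cases m with
    | zero => omega
    | succ m => exact h.decr m (by omega) (by omega)

theorem snoc (h : IsDyadicChain r t n p c e) (he : p + 1 ≤ n → 1 ≤ e n) :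
    IsDyadicChain r (t + 1) (n + 1) p (fun m => if m ≤ n + 1 then c m else t + 1)
      (fun m => if m ≤ n then e m else 0) where
  le := by have := h.le; omega
  first := by simp [h.first]
  last := by simp
  pos := h.pos
  dvd m hm := by
    by_cases hmn : m ≤ n
    · simpa [hmn, hm] using h.dvd m hmn
    · simp [hmn]
  step m hm := by
    rcases Nat.le_succ_iff.1 hm with hmn | rfl
    · simpa [hmn, hm] using h.step m hmn
    · simp [h.last]
  incr m hm := by
    have := h.le
    simpa [show m ≤ n by omega, show m + 1 ≤ n by omega] using h.incr m hm
  decr m hp hm := by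
    rcases Nat.lt_succ_iff_lt_or_eq.1 hm with hmn | rfl
    · simpa [hmn.le, Nat.succ_le_of_lt hmn] using h.decr m hp hmn
    · simpa [Nat.one_le_iff_ne_zero, Nat.pos_iff_ne_zero] using he hp

theorem exists_of_lt : ∀ (t r : ℕ), 1 ≤ r → r < t → ∃ n p c e, IsDyadicChain r t n p c e := by
  intro t
  induction t using Nat.strong_induction_on with
  | _ t ih =>
    intro r hr hrt
    by_cases hmid : (r + 1) / 2 < t / 2
    · obtain ⟨n, p, c, e, h⟩ := ih (t / 2) (by omega) ((r + 1) / 2) (by omega) hmid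
      have h₂ := h.double
      have hleft : ∃ n p c e, IsDyadicChain r (2 * (t / 2)) n p c e ∧ 1 ≤ e n := by
        rcases Nat.even_or_odd' r with ⟨k, rfl | rfl⟩
        · rw [show 2 * ((2 * k + 1) / 2) = 2 * k by omega] at h₂
          exact ⟨_, _, _, _, h₂, by simp⟩
        · rw [show 2 * ((2 * k + 1 + 1) / 2) = 2 * k + 1 + 1 by omega] at h₂
          exact ⟨_, _, _, _, h₂.cons hr (by simp), by simp⟩
      obtain ⟨n, p, c, e, h, he⟩ := hleft
      rcases Nat.even_or_odd' t with ⟨k, hk | hk⟩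
      · rw [show 2 * (t / 2) = t by omega] at h
        exact ⟨_, _, _, _, h⟩
      · have := h.snoc fun _ => he
        rw [show 2 * (t / 2) + 1 = t by omega] at this
        exact ⟨_, _, _, _, this⟩
    · obtain rfl | rfl : t = r + 1 ∨ t = r + 1 + 1 := by omega
      · exact ⟨_, _, _, _, singleton hr⟩
      · exact ⟨_, _, _, _, (singleton hr).snoc (by simp)⟩

theorem isGC (h : IsDyadicChain r t n p c e) {m : ℕ} (hm : m ≤ n) :
    IsGC (c m) (c (m + 1) - 1) := by
  have hpos : ∀ m, m ≤ n → 1 ≤ c m := by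
    intro m
    induction m with
    | zero => intro _; rw [h.first]; exact h.pos
    | succ m ih =>
      intro hm
      rw [h.step m (by omega)]
      exact (ih (by omega)).trans (Nat.le_add_right _ _)
  obtain ⟨i, hi⟩ := h.dvd m hm
  have hc := hpos m hm
  refine ⟨e m, i, ?_, by rw [hi, mul_comm], by rw [h.step m hm, hi]; ring_nf⟩
  rcases Nat.eq_zero_or_pos i with rfl | hi'
  · simp_all
  · exact hi'

theorem length (h : IsDyadicChain r t n p c e) {m : ℕ} (hm : m ≤ n) :
    c (m + 1) - 1 - c m + 1 = 2 ^ e m := by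
  have := h.step m hm
  have := Nat.two_pow_pos (e m)
  omega

end IsDyadicChain

theorem two_mul_two_pow_le {i j : ℕ} (h : i < j) : 2 * 2 ^ i ≤ 2 ^ j := by
  rw [← pow_succ']
  exact Nat.pow_le_pow_right two_pos h

/-- Lemma 1.2 of Daniely et al.: every interval `[r,s]` of positive
integers can be partitioned into consecutive intervals
`I₀ = [a 0, b 0], …, I_n = [a n, b n]` from the geometric covering collection, where
the first `p+1` of them play the role of `I_{−p},…,I_0` and the rest of `I_1,…,I_q`;
the lengths at least double along `I_{−p},…,I_0` (`2·|I_{−i}| ≤ |I_{−i+1}|` for `i ≥ 1`)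
and at least halve along `I_1,…,I_q` (`2·|I_i| ≤ |I_{i−1}|` for `i ≥ 2`). -/
theorem gc_partition (r s : ℕ) (hr : 1 ≤ r) (hrs : r ≤ s) :
    ∃ (n p : ℕ) (a b : ℕ → ℕ), p ≤ n ∧ a 0 = r ∧ b n = s ∧
      (∀ m, m ≤ n → IsGC (a m) (b m)) ∧
      (∀ m, m < n → a (m + 1) = b m + 1) ∧
      (∀ m, m + 1 ≤ p → 2 * (b m - a m + 1) ≤ b (m + 1) - a (m + 1) + 1) ∧
      (∀ m, p + 1 ≤ m → m < n → 2 * (b (m + 1) - a (m + 1) + 1) ≤ b m - a m + 1) := by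
  obtain ⟨n, p, c, e, h⟩ := IsDyadicChain.exists_of_lt (s + 1) r hr (by omega)
  have hle := h.le
  refine ⟨n, p, c, fun m => c (m + 1) - 1, h.le, h.first, by simp [h.last],
    fun m hm => h.isGC hm, fun m hm => ?_, fun m hm => ?_, fun m hp hm => ?_⟩
  · have := h.step m hm.le
    have := Nat.two_pow_pos (e m)
    dsimp only
    omega
  · dsimp only
    rw [h.length (by omega : m ≤ n), h.length (by omega : m + 1 ≤ n)]
    exact two_mul_two_pow_le (h.incr m hm)
  · dsimp only
    rw [h.length hm.le, h.length (by omega : m + 1 ≤ n)]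
    exact two_mul_two_pow_le (h.decr m hp hm)
end

section
/- Fix a positive integer T, a nonempty compact set Ω ⊆ ℝ^d, continuous functions f_1,…,f_T : Ω → ℝ, a constant C ≥ 0, and points w_1,…,w_T ∈ Ω. Suppose that for every interval J = [i,j] in the dense geometric covering collection D with j ≤ T and every w ∈ Ω, Σ_{t=i}^{j} f_t(w_t) − Σ_{t=i}^{j} f_t(w) ≤ C·√(j−i+1). Then for every interval [r,s] ⊆ [1,T] and every w ∈ Ω, Σ_{t=r}^{s} f_t(w_t) − Σ_{t=r}^{s} f_t(w) ≤ 8C·√(s−r+1). -/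
theorem Real.sqrt_add_four_mul_sqrt_le {a b : ℝ} (hb : 0 ≤ b) (hba : b ≤ a) :
    √a + 4 * √b ≤ 4 * √(a + b) := by
  have ha : 0 ≤ a := hb.trans hba
  have h1 := Real.sqrt_le_sqrt hba
  refine abs_le_of_sq_le_sq' ?_ (by positivity) |>.2
  have h2 := Real.sq_sqrt ha
  have h3 := Real.sq_sqrt hb
  have h4 := Real.sq_sqrt (add_nonneg ha hb)
  nlinarith [mul_le_mul_of_nonneg_left h1 (Real.sqrt_nonneg a)]

/-- Every integer interval `[m, n]` contains a multiple of some `2 ^ k` within distance less than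
`2 ^ k` of both endpoints. -/
theorem Nat.exists_dyadic_mem_near_endpoints {m n : ℕ} (hmn : m ≤ n) :
    ∃ k p : ℕ, 2 ^ k ∣ p ∧ m ≤ p ∧ p ≤ n ∧ p < m + 2 ^ k ∧ n < p + 2 ^ k := by
  by_contra! h
  have key : ∀ k, ∃ p, 2 ^ k ∣ p ∧ m ≤ p ∧ p ≤ n := by
    intro k
    induction k with
    | zero => exact ⟨m, by simp, le_rfl, hmn⟩
    | succ k ih =>
      obtain ⟨p, ⟨q, hq⟩, hmp, hpn⟩ := ih
      have hpow : 2 ^ (k + 1) = 2 ^ k * 2 := pow_succ 2 k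
      rcases Nat.even_or_odd' q with ⟨c, rfl | rfl⟩
      · exact ⟨p, ⟨c, by rw [hq, hpow]; ring⟩, hmp, hpn⟩
      · by_cases hlt : p < m + 2 ^ k
        · have := h k p ⟨_, hq⟩ hmp hpn hlt
          exact ⟨p + 2 ^ k, ⟨c + 1, by rw [hq, hpow]; ring⟩, by omega, this⟩
        · refine ⟨p - 2 ^ k, ⟨c, ?_⟩, by omega, by omega⟩
          rw [hq, hpow, Nat.sub_eq_iff_eq_add (Nat.le_mul_of_pos_right _ (by omega))]
          ring
  obtain ⟨p, hdvd, hmp, hpn⟩ := key n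
  have hn : n < 2 ^ n := Nat.lt_two_pow_self
  have hp : p = 0 := Nat.eq_zero_of_dvd_of_lt hdvd (hpn.trans_lt hn)
  have := h n p hdvd hmp hpn (by omega)
  omega

section DyadicIncrements

variable {G : ℕ → ℝ} {C : ℝ} {T : ℕ}

theorem sub_le_four_mul_sqrt_of_dvd_left (hC : 0 ≤ C)
    (hG : ∀ k p : ℕ, 2 ^ k ∣ p → p + 2 ^ k ≤ T → G (p + 2 ^ k) - G p ≤ C * √(2 ^ k))
    (k : ℕ) {p l : ℕ} (hp : 2 ^ k ∣ p) (hl : l < 2 ^ k) (hT : p + l ≤ T) :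
    G (p + l) - G p ≤ 4 * C * √l := by
  induction k generalizing p l with
  | zero =>
    obtain rfl : l = 0 := by simpa using hl
    simp
  | succ k ih =>
    have hp' : 2 ^ k ∣ p := (pow_dvd_pow 2 k.le_succ).trans hp
    rw [pow_succ] at hl
    rcases lt_or_ge l (2 ^ k) with h | h
    · exact ih hp' h hT
    · obtain ⟨e, rfl⟩ := Nat.exists_eq_add_of_le h
      have h1 := hG k p hp' (by omega)
      have h2 := ih (p := p + 2 ^ k) (l := e) (hp'.add dvd_rfl) (by omega) (by omega)
      have he : (e : ℝ) ≤ 2 ^ k := by exact_mod_cast (by omega : e ≤ 2 ^ k)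
      have h3 := mul_le_mul_of_nonneg_left
        (Real.sqrt_add_four_mul_sqrt_le (Nat.cast_nonneg e) he) hC
      rw [← add_assoc]
      push_cast
      linarith

theorem sub_le_four_mul_sqrt_of_dvd_right (hC : 0 ≤ C)
    (hG : ∀ k p : ℕ, 2 ^ k ∣ p → p + 2 ^ k ≤ T → G (p + 2 ^ k) - G p ≤ C * √(2 ^ k))
    (k : ℕ) {m l : ℕ} (hp : 2 ^ k ∣ m + l) (hl : l < 2 ^ k) (hT : m + l ≤ T) :
    G (m + l) - G m ≤ 4 * C * √l := by
  induction k generalizing l with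
  | zero =>
    obtain rfl : l = 0 := by simpa using hl
    simp
  | succ k ih =>
    have hp' : 2 ^ k ∣ m + l := (pow_dvd_pow 2 k.le_succ).trans hp
    rw [pow_succ] at hl
    rcases lt_or_ge l (2 ^ k) with h | h
    · exact ih hp' h hT
    · obtain ⟨e, rfl⟩ := Nat.exists_eq_add_of_le' h
      rw [← add_assoc] at hp' hT ⊢
      have hdvd : 2 ^ k ∣ m + e := (Nat.dvd_add_left dvd_rfl).1 hp'
      have h1 := hG k (m + e) hdvd hT
      have h2 := ih hdvd (by omega) (by omega)
      have he : (e : ℝ) ≤ 2 ^ k := by exact_mod_cast (by omega : e ≤ 2 ^ k)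
      have h3 := mul_le_mul_of_nonneg_left
        (Real.sqrt_add_four_mul_sqrt_le (Nat.cast_nonneg e) he) hC
      rw [add_comm (2 ^ k : ℝ)] at h3
      push_cast
      linarith

/-- If the increments of `G` over the dyadic blocks are at most `C` times the square root of the
block length, then all increments are at most `8 * C` times the square root of the length. -/
theorem sub_le_eight_mul_sqrt (hC : 0 ≤ C)
    (hG : ∀ k p : ℕ, 2 ^ k ∣ p → p + 2 ^ k ≤ T → G (p + 2 ^ k) - G p ≤ C * √(2 ^ k))
    {m n : ℕ} (hmn : m ≤ n) (hT : n ≤ T) :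
    G n - G m ≤ 8 * C * √((n - m : ℕ) : ℝ) := by
  obtain ⟨k, p, hdvd, hmp, hpn, hm, hn⟩ := Nat.exists_dyadic_mem_near_endpoints hmn
  obtain ⟨a, rfl⟩ := Nat.exists_eq_add_of_le hmp
  obtain ⟨b, rfl⟩ := Nat.exists_eq_add_of_le hpn
  have h1 := sub_le_four_mul_sqrt_of_dvd_right hC hG k hdvd (by omega) (by omega)
  have h2 := sub_le_four_mul_sqrt_of_dvd_left hC hG k hdvd (l := b) (by omega) hT
  have bound {x : ℕ} (hx : x ≤ m + a + b - m) :
      4 * C * √(x : ℝ) ≤ 4 * C * √((m + a + b - m : ℕ) : ℝ) := by gcongr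
  linarith [bound (x := a) (by omega), bound (x := b) (by omega)]

end DyadicIncrements

/-- if the sequence `w` has static regret at most `C·√|J|` on every
interval `J ∈ D` with right endpoint at most `T`, then it has static regret at most
`8C·√|I|` on every interval `I = [r,s] ⊆ [1,T]`. -/
theorem regret_extension_dgc
    (d T : ℕ) (C : ℝ) (hC : 0 ≤ C)
    (Ω : Set (EuclideanSpace ℝ (Fin d)))
    (hne : Ω.Nonempty) (hcomp : IsCompact Ω)
    (f : ℕ → EuclideanSpace ℝ (Fin d) → ℝ)
    (hcont : ∀ t, ContinuousOn (f t) Ω)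
    (w : ℕ → EuclideanSpace ℝ (Fin d))
    (hw : ∀ t, 1 ≤ t → t ≤ T → w t ∈ Ω)
    (hbound : ∀ a b : ℕ, IsDGC T a b → b ≤ T → ∀ v ∈ Ω,
      ∑ t ∈ Finset.Icc a b, f t (w t) - ∑ t ∈ Finset.Icc a b, f t v
        ≤ C * Real.sqrt ((b - a + 1 : ℕ) : ℝ))
    (r s : ℕ) (hr : 1 ≤ r) (hrs : r ≤ s) (hsT : s ≤ T) :
    ∀ v ∈ Ω, ∑ t ∈ Finset.Icc r s, f t (w t) - ∑ t ∈ Finset.Icc r s, f t v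
      ≤ 8 * C * Real.sqrt ((s - r + 1 : ℕ) : ℝ) := by
  intro v hv
  let G : ℕ → ℝ := fun n => ∑ t ∈ Finset.range (n + 1), (f t (w t) - f t v)
  have hsum {a b : ℕ} (hab : a ≤ b) : ∑ t ∈ Finset.Icc (a + 1) b, f t (w t)
      - ∑ t ∈ Finset.Icc (a + 1) b, f t v = G b - G a := by
    rw [← Finset.sum_sub_distrib, ← Finset.sum_Ico_eq_sub _ (by omega : a + 1 ≤ b + 1)]
    rfl
  have hG (k p : ℕ) (hp : 2 ^ k ∣ p) (hT : p + 2 ^ k ≤ T) :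
      G (p + 2 ^ k) - G p ≤ C * √(2 ^ k) := by
    obtain ⟨q, rfl⟩ := hp
    have hpos : 0 < 2 ^ k := by positivity
    have h := hbound (2 ^ k * q + 1) (2 ^ k * q + 2 ^ k)
      ⟨k, q + 1, by omega, by omega, by simp [mul_comm], by ring⟩ hT v hv
    rw [hsum (by omega), show 2 ^ k * q + 2 ^ k - (2 ^ k * q + 1) + 1 = 2 ^ k by omega] at h
    exact_mod_cast h
  obtain ⟨m, rfl⟩ := Nat.exists_eq_add_of_le' hr
  rw [hsum (by omega), show s - (m + 1) + 1 = s - m by omega]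
  exact sub_le_eight_mul_sqrt hC hG (by omega) hsT
end

section
/- Under the AOD algorithm with horizon T (losses valued in [0,1]), for every interval J = [i,j] in the dense geometric covering collection D with j ≤ T and every t ∈ J, the meta-regret satisfies Σ_{u=i}^{t} f_u(w_u) − Σ_{u=i}^{t} f_u(w_{u,J}) ≤ √( 3·(t−i+1)·c(t) ), where c(t) = 1 + ln t + ln(1 + log₂ T) + ln( (5 + 3 ln(1+t))/2 ). -/
/-- The AdaNormalHedge potential `Φ(R,C) = exp([R]₊²/(3C))` (with `Φ(R,0) = 1`,
matching `Φ(0,0) = 1`, since `x/0 = 0` in Lean). -/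
noncomputable def anhPot (R C : ℝ) : ℝ := Real.exp (max R 0 ^ 2 / (3 * C))

/-- The AdaNormalHedge weight function `w(R,C) = (Φ(R+1,C+1) − Φ(R−1,C+1))/2`. -/
noncomputable def anhW (R C : ℝ) : ℝ := (anhPot (R + 1) (C + 1) - anhPot (R - 1) (C + 1)) / 2

/-- The starting round `(i−1)·2^k + 1` of the interval of the dense geometric covering
level `D_k` that contains round `t ≥ 1`. -/
def dgcStart (k t : ℕ) : ℕ := (t - 1) / 2 ^ k * 2 ^ k + 1

/-- The levels `k` with `2^k ≤ T` of the dense geometric covering collection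
`D = ∪_{k ≥ 0, 2^k ≤ T} D_k`, `D_k = {[(i−1)·2^k + 1, i·2^k] : i ≥ 1}`.  At every round
exactly one interval of each level is active, so experts are indexed by levels. -/
def dgcLevels (T : ℕ) : Finset ℕ := (Finset.range (T + 1)).filter fun k => 2 ^ k ≤ T

/-- `R_{t−1,I} = Σ_{u=min I}^{t−1} (f_u(w_u) − f_u(w_{u,I}))` for the active level-`k`
expert at round `t` (whose interval starts at `dgcStart k t`); `x k u` is the action of
the level-`k` expert at round `u`. -/
noncomputable def aodMetaR {α : Type*} (f : ℕ → α → ℝ) (w : ℕ → α) (x : ℕ → ℕ → α)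
    (k t : ℕ) : ℝ :=
  ∑ u ∈ Finset.Icc (dgcStart k t) (t - 1), (f u (w u) - f u (x k u))

/-- `C_{t−1,I} = Σ_{u=min I}^{t−1} |f_u(w_u) − f_u(w_{u,I})|` for the active level-`k`
expert at round `t`. -/
noncomputable def aodMetaC {α : Type*} (f : ℕ → α → ℝ) (w : ℕ → α) (x : ℕ → ℕ → α)
    (k t : ℕ) : ℝ :=
  ∑ u ∈ Finset.Icc (dgcStart k t) (t - 1), |f u (w u) - f u (x k u)|

/-- The AdaNormalHedge weight `p_{t,I}` that AOD assigns to the active level-`k`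
expert at round `t`. -/
noncomputable def aodWeight {α : Type*} (T : ℕ) (f : ℕ → α → ℝ) (w : ℕ → α)
    (x : ℕ → ℕ → α) (k t : ℕ) : ℝ :=
  anhW (aodMetaR f w x k t) (aodMetaC f w x k t) /
    ∑ k' ∈ dgcLevels T, anhW (aodMetaR f w x k' t) (aodMetaC f w x k' t)

/-- `c(t) = 1 + ln t + ln(1 + log₂ T) + ln((5 + 3 ln(1+t))/2)`. -/
noncomputable def cAOD (T t : ℕ) : ℝ :=
  1 + Real.log t + Real.log (1 + Real.logb 2 T) + Real.log ((5 + 3 * Real.log (1 + (t : ℝ))) / 2)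

lemma one_le_anhPot (R : ℝ) {C : ℝ} (hC : 0 ≤ C) : 1 ≤ anhPot R C :=
  Real.one_le_exp (by positivity)

lemma anhPot_zero (C : ℝ) : anhPot 0 C = 1 := by
  simp [anhPot]

lemma anhPot_mono {R R' C : ℝ} (hC : 0 ≤ C) (h : R ≤ R') : anhPot R C ≤ anhPot R' C := by
  unfold anhPot
  gcongr

lemma anhW_nonneg (R : ℝ) {C : ℝ} (hC : 0 ≤ C) : 0 ≤ anhW R C := by
  have h := anhPot_mono (R := R - 1) (R' := R + 1) (C := C + 1) (by linarith) (by linarith)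
  unfold anhW
  linarith

lemma anhW_zero_pos : 0 < anhW 0 0 := by
  have : (1 : ℝ) < Real.exp ((1 : ℝ) / 3) := Real.one_lt_exp_iff.2 (by norm_num)
  have h : max (-1 : ℝ) 0 = 0 := by norm_num
  simp only [anhW, anhPot, zero_add, zero_sub, h]
  norm_num at this ⊢

lemma add_sq_div_add_le {a b c d : ℝ} (hc : 0 < c) (hd : 0 < d) :
    (a + b) ^ 2 / (c + d) ≤ a ^ 2 / c + b ^ 2 / d := by
  have h : a ^ 2 / c + b ^ 2 / d - (a + b) ^ 2 / (c + d)
      = (a * d - b * c) ^ 2 / (c * d * (c + d)) := by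
    field_simp
    ring
  have : 0 ≤ (a * d - b * c) ^ 2 / (c * d * (c + d)) := by positivity
  linarith

/-- Joint convexity of the potential along a segment issued from a point of the cone
`|R| ≤ C`. -/
lemma anhPot_segment_le {R C R' C' l : ℝ} (hRC : |R| ≤ C) (hC' : 0 < C')
    (hl0 : 0 ≤ l) (hl1 : l ≤ 1) :
    anhPot ((1 - l) * R + l * R') ((1 - l) * C + l * C')
      ≤ (1 - l) * anhPot R C + l * anhPot R' C' := by
  have hC : 0 ≤ C := (abs_nonneg R).trans hRC
  have hexp : max ((1 - l) * R + l * R') 0 ^ 2 / (3 * ((1 - l) * C + l * C'))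
      ≤ (1 - l) * (max R 0 ^ 2 / (3 * C)) + l * (max R' 0 ^ 2 / (3 * C')) := by
    rcases hl0.eq_or_lt with rfl | hl0
    · simp
    rcases hl1.eq_or_lt with rfl | hl1
    · simp
    have hl1' : 0 < 1 - l := by linarith
    have hmax : max ((1 - l) * R + l * R') 0 ≤ (1 - l) * max R 0 + l * max R' 0 :=
      max_le (by gcongr <;> exact le_max_left _ _) (by positivity)
    rcases hC.eq_or_lt with rfl | hC
    · have hR : R = 0 := abs_nonpos_iff.1 hRC
      subst hR
      simp only [mul_zero, zero_add, max_self] at hmax ⊢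
      calc max (l * R') 0 ^ 2 / (3 * (l * C'))
          ≤ (l * max R' 0) ^ 2 / (3 * (l * C')) := by gcongr
        _ ≤ _ := by
          apply le_of_eq
          field_simp
          simp
    · calc max ((1 - l) * R + l * R') 0 ^ 2 / (3 * ((1 - l) * C + l * C'))
          ≤ ((1 - l) * max R 0 + l * max R' 0) ^ 2 / (3 * ((1 - l) * C + l * C')) := by gcongr
        _ = ((1 - l) * max R 0 + l * max R' 0) ^ 2
              / ((1 - l) * (3 * C) + l * (3 * C')) := by
          congr 1
          ring
        _ ≤ ((1 - l) * max R 0) ^ 2 / ((1 - l) * (3 * C))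
              + (l * max R' 0) ^ 2 / (l * (3 * C')) :=
          add_sq_div_add_le (by positivity) (by positivity)
        _ = _ := by
          field_simp
  have hconv := convexOn_exp.2 (Set.mem_univ (max R 0 ^ 2 / (3 * C)))
    (Set.mem_univ (max R' 0 ^ 2 / (3 * C'))) (sub_nonneg.2 hl1) hl0 (by ring)
  simp only [smul_eq_mul] at hconv
  exact (Real.exp_le_exp.2 hexp).trans hconv

lemma anhPot_add_anhPot_le {R C : ℝ} (hRC : |R| ≤ C) :
    anhPot (R + 1) (C + 1) + anhPot (R - 1) (C + 1) ≤ 2 * anhPot R C + 2 := by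
  have hC : 0 ≤ C := (abs_nonneg R).trans hRC
  have he := Real.exp_one_lt_d9
  rcases le_total R 0 with hR | hR
  · have h0 := one_le_anhPot R hC
    have h1 : anhPot (R - 1) (C + 1) ≤ 1 := by
      have h := anhPot_mono (R := R - 1) (R' := 0) (C := C + 1) (by linarith) (by linarith)
      rwa [anhPot_zero] at h
    have h2 : anhPot (R + 1) (C + 1) ≤ Real.exp 1 := by
      refine (anhPot_mono (R' := 1) (by linarith) (by linarith)).trans ?_
      refine Real.exp_le_exp.2 ?_
      rw [div_le_one (by positivity)]
      norm_num
      linarith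
    linarith
  · have hplus : anhPot (R + 1) (C + 1) = Real.exp ((R + 1) ^ 2 / (3 * (C + 1))) := by
      rw [anhPot, max_eq_left (by linarith)]
    have hminus : anhPot (R - 1) (C + 1) ≤ Real.exp ((R - 1) ^ 2 / (3 * (C + 1))) := by
      refine Real.exp_le_exp.2 ?_
      refine div_le_div_of_nonneg_right ?_ (by positivity)
      rcases le_total (R - 1) 0 with h | h
      · rw [max_eq_right h, zero_pow two_ne_zero]
        positivity
      · rw [max_eq_left h]
    have hzero : anhPot R C = Real.exp (R ^ 2 / (3 * C)) := by
      rw [anhPot, max_eq_left hR]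
    set s : ℝ := 1 / (3 * (C + 1)) with hs
    have hs0 : 0 ≤ s := by positivity
    have hs1 : s ≤ 1 / 3 := by
      rw [hs]
      exact one_div_le_one_div_of_le (by norm_num) (by linarith)
    set y : ℝ := R ^ 2 / (3 * C) with hy
    have hsum : Real.exp ((R + 1) ^ 2 / (3 * (C + 1))) + Real.exp ((R - 1) ^ 2 / (3 * (C + 1)))
        = 2 * (Real.exp ((R ^ 2 + 1) * s) * Real.cosh (2 * R * s)) := by
      rw [Real.cosh_eq]
      have h1 : (R + 1) ^ 2 / (3 * (C + 1)) = (R ^ 2 + 1) * s + 2 * R * s := by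
        rw [hs]
        ring
      have h2 : (R - 1) ^ 2 / (3 * (C + 1)) = (R ^ 2 + 1) * s + -(2 * R * s) := by
        rw [hs]
        ring
      rw [h1, h2, Real.exp_add, Real.exp_add]
      ring
    have hexp : (R ^ 2 + 1) * s + (2 * R * s) ^ 2 / 2 ≤ (1 - s) * y + s * 1 := by
      rcases hC.eq_or_lt with rfl | hC
      · have hR0 : R = 0 := abs_nonpos_iff.1 hRC
        simp [hy, hR0]
      · have : (1 - s) * y + s * 1 - ((R ^ 2 + 1) * s + (2 * R * s) ^ 2 / 2)
            = R ^ 2 * (2 / (9 * C * (C + 1) ^ 2)) := by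
          rw [hs, hy]
          field_simp
          ring
        have : 0 ≤ R ^ 2 * (2 / (9 * C * (C + 1) ^ 2)) := by positivity
        linarith
    have hconv := convexOn_exp.2 (Set.mem_univ y) (Set.mem_univ 1)
      (show 0 ≤ 1 - s by linarith) hs0 (by ring)
    simp only [smul_eq_mul] at hconv
    have hcosh : Real.exp ((R ^ 2 + 1) * s) * Real.cosh (2 * R * s)
        ≤ (1 - s) * Real.exp y + s * Real.exp 1 :=
      calc Real.exp ((R ^ 2 + 1) * s) * Real.cosh (2 * R * s)
          ≤ Real.exp ((R ^ 2 + 1) * s) * Real.exp ((2 * R * s) ^ 2 / 2) := by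
            gcongr
            exact Real.cosh_le_exp_half_sq _
        _ = Real.exp ((R ^ 2 + 1) * s + (2 * R * s) ^ 2 / 2) := (Real.exp_add _ _).symm
        _ ≤ Real.exp ((1 - s) * y + s * 1) := Real.exp_le_exp.2 hexp
        _ ≤ _ := hconv
    have hsy : 0 ≤ s * Real.exp y := by positivity
    have hse : s * Real.exp 1 ≤ 1 := by nlinarith
    rw [hzero, hplus]
    linarith

lemma anhPot_add_le {R C r : ℝ} (hRC : |R| ≤ C) (hr : |r| ≤ 1) :
    anhPot (R + r) (C + |r|) ≤ anhPot R C + anhW R C * r + 1 := by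
  have hC : 0 ≤ C := (abs_nonneg R).trans hRC
  have hsum := anhPot_add_anhPot_le hRC
  rcases le_total 0 r with h | h
  · rw [abs_of_nonneg h] at hr ⊢
    have hseg := anhPot_segment_le (R' := R + 1) hRC (show 0 < C + 1 by linarith) h hr
    have h1 : (1 - r) * R + r * (R + 1) = R + r := by ring
    have h2 : (1 - r) * C + r * (C + 1) = C + r := by ring
    rw [h1, h2] at hseg
    unfold anhW
    nlinarith
  · rw [abs_of_nonpos h] at hr ⊢
    have hseg := anhPot_segment_le (R' := R - 1) hRC (show 0 < C + 1 by linarith)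
      (neg_nonneg.2 h) hr
    have h1 : (1 - -r) * R + -r * (R - 1) = R + r := by ring
    have h2 : (1 - -r) * C + -r * (C + 1) = C + -r := by ring
    rw [h1, h2] at hseg
    unfold anhW
    nlinarith

lemma le_sqrt_of_anhPot_le {R C L B : ℝ} (hRC : |R| ≤ C) (hCL : C ≤ L) (hB : 1 ≤ B)
    (h : anhPot R C ≤ B) : R ≤ Real.sqrt (3 * L * Real.log B) := by
  have hlog := Real.log_nonneg hB
  rcases le_or_gt R 0 with hR | hR
  · exact hR.trans (Real.sqrt_nonneg _)
  have hC : 0 < C := hR.trans_le ((le_abs_self R).trans hRC)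
  have h1 : max R 0 ^ 2 / (3 * C) ≤ Real.log B :=
    (Real.le_log_iff_exp_le (by linarith)).2 h
  rw [max_eq_left hR.le, div_le_iff₀ (by positivity)] at h1
  refine Real.le_sqrt_of_sq_le ?_
  nlinarith

lemma dgcStart_one (k : ℕ) : dgcStart k 1 = 1 := by
  simp [dgcStart]

lemma dgcStart_zero_left {t : ℕ} (ht : 1 ≤ t) : dgcStart 0 t = t := by
  simp only [dgcStart, pow_zero, Nat.div_one, mul_one]
  omega

lemma dgcStart_le (k : ℕ) {t : ℕ} (ht : 1 ≤ t) : dgcStart k t ≤ t := by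
  have := Nat.div_mul_le_self (t - 1) (2 ^ k)
  unfold dgcStart
  omega

lemma dgcStart_succ (k : ℕ) {t : ℕ} (ht : 1 ≤ t) :
    dgcStart k (t + 1) = t + 1 ∨ dgcStart k (t + 1) = dgcStart k t := by
  obtain ⟨s, rfl⟩ : ∃ s, t = s + 1 := ⟨t - 1, by omega⟩
  by_cases h : 2 ^ k ∣ s + 1
  · left
    simp [dgcStart, Nat.div_mul_cancel h]
  · right
    simp [dgcStart, Nat.succ_div, h]

lemma dgcStart_eq {k i t : ℕ} (hi : 1 ≤ i) (h1 : (i - 1) * 2 ^ k + 1 ≤ t)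
    (h2 : t ≤ i * 2 ^ k) : dgcStart k t = (i - 1) * 2 ^ k + 1 := by
  obtain ⟨j, rfl⟩ : ∃ j, i = j + 1 := ⟨i - 1, by omega⟩
  have : (t - 1) / 2 ^ k = j := by
    rw [Nat.div_eq_iff (by positivity)]
    simp only [add_tsub_cancel_right] at h1
    rw [add_mul] at h2
    omega
  simp [dgcStart, this]

lemma mem_dgcLevels {k T : ℕ} : k ∈ dgcLevels T ↔ 2 ^ k ≤ T := by
  simp only [dgcLevels, Finset.mem_filter, Finset.mem_range, and_iff_right_iff_imp]
  intro h
  have := Nat.lt_two_pow_self (n := k)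
  omega

lemma card_dgcLevels_le {T : ℕ} (hT : 1 ≤ T) :
    ((dgcLevels T).card : ℝ) ≤ 1 + Real.logb 2 T := by
  have hsub : dgcLevels T ⊆ Finset.range (Nat.log 2 T + 1) := by
    intro k hk
    rw [Finset.mem_range, Nat.lt_succ_iff]
    exact (Nat.le_log_iff_pow_le (by norm_num) (by omega)).2 (mem_dgcLevels.1 hk)
  have hcard := Finset.card_le_card hsub
  rw [Finset.card_range] at hcard
  have hlog : (Nat.log 2 T : ℝ) ≤ Real.logb 2 T := by
    exact_mod_cast Real.natLog_le_logb T 2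
  have : ((dgcLevels T).card : ℝ) ≤ Nat.log 2 T + 1 := by exact_mod_cast hcard
  linarith

section MetaRegret

variable {α : Type*} {T : ℕ} {f : ℕ → α → ℝ} {w : ℕ → α} {x : ℕ → ℕ → α}

lemma aodMetaC_nonneg (k t : ℕ) : 0 ≤ aodMetaC f w x k t :=
  Finset.sum_nonneg fun _ _ => abs_nonneg _

lemma abs_aodMetaR_le (k t : ℕ) : |aodMetaR f w x k t| ≤ aodMetaC f w x k t :=
  Finset.abs_sum_le_sum_abs _ _

lemma sum_anhW_pos (hT : 1 ≤ T) {t : ℕ} (ht : 1 ≤ t) :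
    0 < ∑ k ∈ dgcLevels T, anhW (aodMetaR f w x k t) (aodMetaC f w x k t) := by
  refine Finset.sum_pos' (fun k _ => anhW_nonneg _ (aodMetaC_nonneg k t))
    ⟨0, mem_dgcLevels.2 (by simpa using hT), ?_⟩
  have hempty : Finset.Icc t (t - 1) = ∅ := Finset.Icc_eq_empty (by omega)
  simpa [aodMetaR, aodMetaC, dgcStart_zero_left ht, hempty] using anhW_zero_pos

lemma aodWeight_nonneg (k t : ℕ) : 0 ≤ aodWeight T f w x k t :=
  div_nonneg (anhW_nonneg _ (aodMetaC_nonneg k t))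
    (Finset.sum_nonneg fun k' _ => anhW_nonneg _ (aodMetaC_nonneg k' t))

lemma sum_aodWeight (hT : 1 ≤ T) {t : ℕ} (ht : 1 ≤ t) :
    ∑ k ∈ dgcLevels T, aodWeight T f w x k t = 1 := by
  unfold aodWeight
  rw [← Finset.sum_div, div_self (sum_anhW_pos hT ht).ne']

/-- The potential of the active level-`k` expert at the end of round `t`. -/
noncomputable def aodPot (f : ℕ → α → ℝ) (w : ℕ → α) (x : ℕ → ℕ → α) (k t : ℕ) : ℝ :=
  anhPot (∑ u ∈ Finset.Icc (dgcStart k t) t, (f u (w u) - f u (x k u)))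
    (∑ u ∈ Finset.Icc (dgcStart k t) t, |f u (w u) - f u (x k u)|)

lemma anhPot_aodMeta_one (k : ℕ) :
    anhPot (aodMetaR f w x k 1) (aodMetaC f w x k 1) = 1 := by
  simp [aodMetaR, dgcStart_one, anhPot_zero]

lemma anhPot_aodMeta_succ_le (k : ℕ) {t : ℕ} (ht : 1 ≤ t) :
    anhPot (aodMetaR f w x k (t + 1)) (aodMetaC f w x k (t + 1)) ≤ aodPot f w x k t := by
  rcases dgcStart_succ k ht with h | h
  · have h1 : aodMetaR f w x k (t + 1) = 0 := by simp [aodMetaR, h]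
    rw [h1, anhPot_zero]
    exact one_le_anhPot _ (Finset.sum_nonneg fun _ _ => abs_nonneg _)
  · simp [aodMetaR, aodMetaC, aodPot, h]

lemma aodPot_le (k : ℕ) {t : ℕ} (ht : 1 ≤ t) (hr : |f t (w t) - f t (x k t)| ≤ 1) :
    aodPot f w x k t ≤ anhPot (aodMetaR f w x k t) (aodMetaC f w x k t)
      + anhW (aodMetaR f w x k t) (aodMetaC f w x k t) * (f t (w t) - f t (x k t)) + 1 := by
  have key (g : ℕ → ℝ) : ∑ u ∈ Finset.Icc (dgcStart k t) t, g u
      = ∑ u ∈ Finset.Icc (dgcStart k t) (t - 1), g u + g t := by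
    obtain ⟨s, rfl⟩ : ∃ s, t = s + 1 := ⟨t - 1, by omega⟩
    exact Finset.sum_Icc_succ_top (dgcStart_le k ht) g
  rw [aodPot, key, key]
  exact anhPot_add_le (abs_aodMetaR_le k t) hr

lemma sum_anhW_mul_nonpos (hT : 1 ≤ T) {t : ℕ} (ht : 1 ≤ t)
    (hjensen : f t (w t) ≤ ∑ k ∈ dgcLevels T, aodWeight T f w x k t * f t (x k t)) :
    ∑ k ∈ dgcLevels T, anhW (aodMetaR f w x k t) (aodMetaC f w x k t)
      * (f t (w t) - f t (x k t)) ≤ 0 := by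
  have hW := sum_anhW_pos (f := f) (w := w) (x := x) hT ht
  have hp : ∑ k ∈ dgcLevels T, aodWeight T f w x k t * f t (x k t)
      = (∑ k ∈ dgcLevels T, anhW (aodMetaR f w x k t) (aodMetaC f w x k t) * f t (x k t))
        / ∑ k ∈ dgcLevels T, anhW (aodMetaR f w x k t) (aodMetaC f w x k t) := by
    rw [Finset.sum_div]
    exact Finset.sum_congr rfl fun k _ => by rw [aodWeight]; ring
  rw [hp, le_div_iff₀ hW] at hjensen
  simp only [mul_sub, Finset.sum_sub_distrib, ← Finset.sum_mul]
  linarith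

lemma sum_aodPot_le (hT : 1 ≤ T) (hr : ∀ k t, 1 ≤ t → |f t (w t) - f t (x k t)| ≤ 1)
    (hjensen : ∀ t, 1 ≤ t →
      f t (w t) ≤ ∑ k ∈ dgcLevels T, aodWeight T f w x k t * f t (x k t))
    {t : ℕ} (ht : 1 ≤ t) :
    ∑ k ∈ dgcLevels T, aodPot f w x k t ≤ (dgcLevels T).card * (1 + (t : ℝ)) := by
  have hround (t : ℕ) (ht : 1 ≤ t) : ∑ k ∈ dgcLevels T, aodPot f w x k t
      ≤ ∑ k ∈ dgcLevels T, anhPot (aodMetaR f w x k t) (aodMetaC f w x k t)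
        + (dgcLevels T).card := by
    have h := Finset.sum_le_sum fun k (_ : k ∈ dgcLevels T) => aodPot_le k ht (hr k t ht)
    simp only [Finset.sum_add_distrib, Finset.sum_const, nsmul_eq_mul, mul_one] at h
    linarith [sum_anhW_mul_nonpos hT ht (hjensen t ht)]
  induction t, ht using Nat.le_induction with
  | base =>
    have h := hround 1 le_rfl
    simp only [anhPot_aodMeta_one, Finset.sum_const, nsmul_eq_mul, mul_one] at h
    push_cast
    linarith
  | succ t ht ih =>
    have h := hround (t + 1) (by omega)
    have h' := Finset.sum_le_sum fun k (_ : k ∈ dgcLevels T) =>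
      anhPot_aodMeta_succ_le (f := f) (w := w) (x := x) k ht
    push_cast
    linarith

end MetaRegret

lemma log_card_dgcLevels_mul_le {T t : ℕ} (hT : 1 ≤ T) (ht : 1 ≤ t) :
    Real.log ((dgcLevels T).card * (1 + (t : ℝ))) ≤ cAOD T t := by
  have ht' : (1 : ℝ) ≤ t := by exact_mod_cast ht
  have hcard : 0 < (dgcLevels T).card :=
    Finset.card_pos.2 ⟨0, mem_dgcLevels.2 (by simpa using hT)⟩
  have hcard' : (0 : ℝ) < (dgcLevels T).card := by exact_mod_cast hcard
  have hN := card_dgcLevels_le hT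
  have hlog : 0 ≤ Real.log (1 + (t : ℝ)) := Real.log_nonneg (by linarith)
  have hle : (dgcLevels T).card * (1 + (t : ℝ))
      ≤ t * (1 + Real.logb 2 T) * ((5 + 3 * Real.log (1 + (t : ℝ))) / 2) :=
    calc (dgcLevels T).card * (1 + (t : ℝ))
        ≤ (1 + Real.logb 2 T) * (t * ((5 + 3 * Real.log (1 + (t : ℝ))) / 2)) := by
          gcongr
          · linarith
          · nlinarith
      _ = _ := by ring
  have hN' : 0 < 1 + Real.logb 2 T := hcard'.trans_le hN
  have h := Real.log_le_log (by positivity) hle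
  rw [Real.log_mul (x := t * (1 + Real.logb 2 T)) (by positivity) (by positivity),
    Real.log_mul (x := (t : ℝ)) (by positivity) hN'.ne'] at h
  unfold cAOD
  linarith

/-- Lemma 1, meta-regret of AOD: under the AOD algorithm with
horizon `T` and losses valued in `[0,1]`, for every interval
`J = [(i−1)·2^k + 1, i·2^k]` of the dense geometric covering collection with
`i·2^k ≤ T` and every round `t ∈ J`,
`Σ_{u=min J}^{t} (f_u(w_u) − f_u(w_{u,J})) ≤ √(3·(t − min J + 1)·c(t))`. -/
theorem aod_meta_regret
    (d T : ℕ) (hT : 1 ≤ T) (D G : ℝ)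
    (Ω : Set (EuclideanSpace ℝ (Fin d)))
    (hne : Ω.Nonempty) (hcomp : IsCompact Ω) (hconv : Convex ℝ Ω)
    (hdiam : ∀ z ∈ Ω, ∀ z' ∈ Ω, ‖z - z'‖ ≤ D)
    (f : ℕ → EuclideanSpace ℝ (Fin d) → ℝ)
    (hfconv : ∀ t, ConvexOn ℝ Set.univ (f t))
    (hfdiff : ∀ t z, DifferentiableAt ℝ (f t) z)
    (hgrad : ∀ t, ∀ z ∈ Ω, ‖gradient (f t) z‖ ≤ G)
    (hrange : ∀ t, ∀ z ∈ Ω, 0 ≤ f t z ∧ f t z ≤ 1)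
    (proj : EuclideanSpace ℝ (Fin d) → EuclideanSpace ℝ (Fin d))
    (hproj : ∀ z, proj z ∈ Ω ∧ ∀ z' ∈ Ω, ‖proj z - z‖ ≤ ‖z' - z‖)
    (x : ℕ → ℕ → EuclideanSpace ℝ (Fin d))
    (hx1 : ∀ k, x k 1 ∈ Ω)
    (hxup : ∀ k t, 1 ≤ t →
      x k (t + 1) = proj (x k t - (D / (G * Real.sqrt ((2 : ℝ) ^ k))) • gradient (f t) (x k t)))
    (w : ℕ → EuclideanSpace ℝ (Fin d))
    (hw : ∀ t, 1 ≤ t → w t = ∑ k ∈ dgcLevels T, aodWeight T f w x k t • x k t)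
    (k i t : ℕ) (hk : 2 ^ k ≤ T) (hi : 1 ≤ i) (hiT : i * 2 ^ k ≤ T)
    (ht1 : (i - 1) * 2 ^ k + 1 ≤ t) (ht2 : t ≤ i * 2 ^ k) :
    ∑ u ∈ Finset.Icc ((i - 1) * 2 ^ k + 1) t, (f u (w u) - f u (x k u))
      ≤ Real.sqrt (3 * ((t - ((i - 1) * 2 ^ k + 1) + 1 : ℕ) : ℝ) * cAOD T t) := by
  have hxmem (k t : ℕ) (ht : 1 ≤ t) : x k t ∈ Ω := by
    induction t, ht using Nat.le_induction with
    | base => exact hx1 k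
    | succ t ht _ =>
      rw [hxup k t ht]
      exact (hproj _).1
  have hwmem (t : ℕ) (ht : 1 ≤ t) : w t ∈ Ω := by
    rw [hw t ht]
    exact hconv.sum_mem (fun k _ => aodWeight_nonneg k t) (sum_aodWeight hT ht)
      fun k _ => hxmem k t ht
  have hjensen (t : ℕ) (ht : 1 ≤ t) :
      f t (w t) ≤ ∑ k ∈ dgcLevels T, aodWeight T f w x k t * f t (x k t) := by
    have h := (hfconv t).map_sum_le (t := dgcLevels T) (w := fun k => aodWeight T f w x k t)
      (p := fun k => x k t) (fun k _ => aodWeight_nonneg k t) (sum_aodWeight hT ht)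
      fun _ _ => Set.mem_univ _
    rw [← hw t ht] at h
    simpa only [smul_eq_mul] using h
  have hr (k t : ℕ) (ht : 1 ≤ t) : |f t (w t) - f t (x k t)| ≤ 1 := by
    have h1 := hrange t _ (hwmem t ht)
    have h2 := hrange t _ (hxmem k t ht)
    rw [abs_le]
    constructor <;> linarith
  have ht : 1 ≤ t := by omega
  have hkmem : k ∈ dgcLevels T := mem_dgcLevels.2 hk
  have hpot : aodPot f w x k t ≤ (dgcLevels T).card * (1 + (t : ℝ)) :=
    (Finset.single_le_sum (f := fun k => aodPot f w x k t)
      (fun k _ => zero_le_one.trans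
        (one_le_anhPot _ (Finset.sum_nonneg fun _ _ => abs_nonneg _))) hkmem).trans
      (sum_aodPot_le hT hr hjensen ht)
  rw [aodPot, dgcStart_eq hi ht1 ht2] at hpot
  have hC : ∑ u ∈ Finset.Icc ((i - 1) * 2 ^ k + 1) t, |f u (w u) - f u (x k u)|
      ≤ ((t - ((i - 1) * 2 ^ k + 1) + 1 : ℕ) : ℝ) := by
    have h := Finset.sum_le_card_nsmul (Finset.Icc ((i - 1) * 2 ^ k + 1) t)
      (fun u => |f u (w u) - f u (x k u)|) 1 fun u hu =>
        hr k u (by have := (Finset.mem_Icc.1 hu).1; omega)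
    have hlen : (Finset.Icc ((i - 1) * 2 ^ k + 1) t).card = t - ((i - 1) * 2 ^ k + 1) + 1 := by
      rw [Nat.card_Icc]
      omega
    rwa [hlen, nsmul_eq_mul, mul_one] at h
  have hB := (one_le_anhPot _ (Finset.sum_nonneg fun _ _ => abs_nonneg _)).trans hpot
  refine (le_sqrt_of_anhPot_le (Finset.abs_sum_le_sum_abs _ _) hC hB hpot).trans ?_
  gcongr
  exact log_card_dgcLevels_mul_le hT ht
end
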